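/- arXiv:2205.10022 — 2 statements merged into one kernel-verified Lean document; each statement's English description precedes it below -/
import Mathlib

section
/- Under the assumptions of the strong duality setting (X proper Polish with the midpoint property, φ a 0/1-like margin loss, P Borel on X × {−1,+1}, ε ≥ 0), strong duality holds for φ: inf_{f measurable} sup_{Q ∈ A_ε(P)} R_{φ,Q}(f) = sup_{Q ∈ A_ε(P)} inf_{f measurable} R_{φ,Q}(f), and the supremum on the right-hand side is attained. -/
open MeasureTheory Metric Filter Set

/-- Sign with the convention `sign 0 = 1`. -/
noncomputable def sgn (t : ℝ) : ℝ := if 0 ≤ t then 1 else -1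

/-- The 0/1 loss `l_{0/1}(y, t) = 1_{y · sign(t) ≤ 0}` (as a function of the label and of `f x`). -/
noncomputable def l01 : ℝ → ℝ → ℝ := fun y t => if y * sgn t ≤ 0 then 1 else 0

/-- The margin loss associated with `φ`: `(y, t) ↦ φ(y t)`. -/
noncomputable def margin (φ : ℝ → ℝ) : ℝ → ℝ → ℝ := fun y t => φ (y * t)

/-- The adversarial version of a loss `L`: `sup_{x' ∈ B_ε(x)} L(y, f x')`. -/
noncomputable def advLoss {X : Type*} [MetricSpace X] (L : ℝ → ℝ → ℝ) (ε : ℝ) (x : X)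
    (y : ℝ) (f : X → ℝ) : ℝ :=
  ⨆ x' : closedBall x ε, L y (f x')

/-- The calibration function of the adversarial loss:
`C(x, η, f) = η L_ε(x, 1, f) + (1-η) L_ε(x, -1, f)`. -/
noncomputable def advCal {X : Type*} [MetricSpace X] (L : ℝ → ℝ → ℝ) (ε : ℝ) (x : X)
    (η : ℝ) (f : X → ℝ) : ℝ :=
  η * advLoss L ε x 1 f + (1 - η) * advLoss L ε x (-1) f

/-- Optimal adversarial calibration function (infimum over measurable functions). -/
noncomputable def advCalStar (X : Type*) [MetricSpace X] [MeasurableSpace X]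
    (L : ℝ → ℝ → ℝ) (ε : ℝ) (x : X) (η : ℝ) : ℝ :=
  ⨅ f : {f : X → ℝ // Measurable f}, advCal L ε x η f.1

/-- Standard (non-adversarial) calibration function. -/
noncomputable def stdCal {X : Type*} (L : ℝ → ℝ → ℝ) (x : X) (η : ℝ) (f : X → ℝ) : ℝ :=
  η * L 1 (f x) + (1 - η) * L (-1) (f x)

/-- Optimal standard calibration function (infimum over measurable functions). -/
noncomputable def stdCalStar (X : Type*) [MeasurableSpace X] [TopologicalSpace X]
    (L : ℝ → ℝ → ℝ) (x : X) (η : ℝ) : ℝ :=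
  ⨅ f : {f : X → ℝ // Measurable f}, stdCal L x η f.1

/-- Standard risk of `f` for the loss `L` under a distribution `Q` on `X × ℝ`
(labels are the real values `±1`). -/
noncomputable def stdRisk {X : Type*} [MeasurableSpace X] (L : ℝ → ℝ → ℝ)
    (Q : Measure (X × ℝ)) (f : X → ℝ) : ℝ :=
  ∫ p, L p.2 (f p.1) ∂Q

/-- Adversarial risk of `f` at level `ε` for the loss `L` under `P`. -/
noncomputable def advRisk {X : Type*} [MetricSpace X] [MeasurableSpace X] (L : ℝ → ℝ → ℝ)
    (ε : ℝ) (P : Measure (X × ℝ)) (f : X → ℝ) : ℝ :=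
  ∫ p, advLoss L ε p.1 p.2 f ∂P

/-- `φ` is calibrated (w.r.t. the 0/1 loss) in the standard classification setting;
for margin losses this is a pointwise condition on the real line. -/
def StdCalibrated (φ : ℝ → ℝ) : Prop :=
  ∀ ξ > (0:ℝ), ∀ η ∈ Icc (0:ℝ) 1, ∃ δ > (0:ℝ), ∀ α : ℝ,
    η * φ α + (1 - η) * φ (-α) - (⨅ β : ℝ, η * φ β + (1 - η) * φ (-β)) ≤ δ →
    η * l01 1 α + (1 - η) * l01 (-1) α - min η (1 - η) ≤ ξ

/-- `φ` is uniformly calibrated in the standard classification setting. -/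
def StdUnifCalibrated (φ : ℝ → ℝ) : Prop :=
  ∀ ξ > (0:ℝ), ∃ δ > (0:ℝ), ∀ η ∈ Icc (0:ℝ) 1, ∀ α : ℝ,
    η * φ α + (1 - η) * φ (-α) - (⨅ β : ℝ, η * φ β + (1 - η) * φ (-β)) ≤ δ →
    η * l01 1 α + (1 - η) * l01 (-1) α - min η (1 - η) ≤ ξ

/-- `φ` is adversarially calibrated at level `ε`. -/
def AdvCalibrated (X : Type*) [MetricSpace X] [MeasurableSpace X] (φ : ℝ → ℝ) (ε : ℝ) : Prop :=
  ∀ ξ > (0:ℝ), ∀ η ∈ Icc (0:ℝ) 1, ∀ x : X, ∃ δ > (0:ℝ), ∀ f : X → ℝ, Measurable f →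
    advCal (margin φ) ε x η f - advCalStar X (margin φ) ε x η ≤ δ →
    advCal l01 ε x η f - advCalStar X l01 ε x η ≤ ξ

/-- The set `A_ε(P)` of adversarial distributions: distributions obtained from `P` by a
coupling moving each point by at most `ε` in `x` and preserving the label. -/
def advSet {X : Type*} [MetricSpace X] [MeasurableSpace X]
    (P : Measure (X × ℝ)) (ε : ℝ) : Set (Measure (X × ℝ)) :=
  {Q | IsProbabilityMeasure Q ∧ ∃ γ : Measure ((X × ℝ) × (X × ℝ)),
    IsProbabilityMeasure γ ∧ γ.map Prod.fst = P ∧ γ.map Prod.snd = Q ∧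
    γ {p : (X × ℝ) × (X × ℝ) | dist p.1.1 p.2.1 ≤ ε ∧ p.1.2 = p.2.2} = 1}

open scoped BoundedContinuousFunction Topology

theorem aux_minimax {Z : Type*} [TopologicalSpace Z] [MeasurableSpace Z] [OpensMeasurableSpace Z]
    (K : Set (ProbabilityMeasure Z)) (hK : IsCompact K) (hne : K.Nonempty)
    (hconv : ∀ μ ∈ K, ∀ ν ∈ K, ∀ a b : ℝ, 0 ≤ a → 0 ≤ b → a + b = 1 → ∃ ρ ∈ K,
      (ρ : Measure Z) = ENNReal.ofReal a • (μ : Measure Z) + ENNReal.ofReal b • (ν : Measure Z))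
    (C : Set (Z →ᵇ ℝ)) (hC : Convex ℝ C) (V : ℝ)
    (h : ∀ c ∈ C, ∀ v < V, ∃ γ ∈ K, v < ∫ z, c z ∂(γ : Measure Z)) :
    ∃ γ ∈ K, ∀ c ∈ C, V ≤ ∫ z, c z ∂(γ : Measure Z) := by
  by_contra hcon
  push Not at hcon
  obtain ⟨t, ht⟩ := hK.elim_finite_subcover
    (fun c : C => {γ : ProbabilityMeasure Z | ∫ z, c.1 z ∂(γ : Measure Z) < V})
    (fun c => isOpen_lt (ProbabilityMeasure.continuous_integral_boundedContinuousFunction c.1)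
      continuous_const)
    (fun γ hγ => by
      obtain ⟨c, hc, hlt⟩ := hcon γ hγ
      exact mem_iUnion.2 ⟨⟨c, hc⟩, hlt⟩)
  let Φ : ProbabilityMeasure Z → (t → ℝ) := fun γ c => ∫ z, c.1.1 z ∂(γ : Measure Z)
  have hΦ : Continuous Φ := continuous_pi fun c =>
    ProbabilityMeasure.continuous_integral_boundedContinuousFunction c.1.1
  have him : IsCompact (Φ '' K) := hK.image hΦ
  have himc : Convex ℝ (Φ '' K) := by
    rintro _ ⟨μ, hμ, rfl⟩ _ ⟨ν, hν, rfl⟩ a b ha hb hab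
    obtain ⟨ρ, hρ, hρe⟩ := hconv μ hμ ν hν a b ha hb hab
    refine ⟨ρ, hρ, ?_⟩
    ext c
    simp only [Φ, Pi.add_apply, Pi.smul_apply, smul_eq_mul]
    rw [hρe, integral_add_measure, integral_smul_measure, integral_smul_measure]
    · simp [ENNReal.toReal_ofReal, ha, hb]
    · exact (c.1.1.integrable _).smul_measure ENNReal.ofReal_ne_top
    · exact (c.1.1.integrable _).smul_measure ENNReal.ofReal_ne_top
  have hTc : Convex ℝ {y : t → ℝ | ∀ c, V ≤ y c} := by
    intro x hx y hy a b ha hb hab c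
    have h1 := mul_le_mul_of_nonneg_left (hx c) ha
    have h2 := mul_le_mul_of_nonneg_left (hy c) hb
    simp only [Pi.add_apply, Pi.smul_apply, smul_eq_mul]
    have : V = a * V + b * V := by rw [← add_mul, hab, one_mul]
    linarith
  have hTcl : IsClosed {y : t → ℝ | ∀ c, V ≤ y c} := by
    simp only [Set.ofPred_forall]
    exact isClosed_iInter fun c => isClosed_le continuous_const (continuous_apply c)
  have hdisj : Disjoint (Φ '' K) {y : t → ℝ | ∀ c, V ≤ y c} := by
    rw [Set.disjoint_left]
    rintro _ ⟨γ, hγ, rfl⟩ hy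
    obtain ⟨c, hc⟩ := mem_iUnion.1 (ht hγ)
    obtain ⟨hct, hlt⟩ := mem_iUnion.1 hc
    exact absurd (hy ⟨c, hct⟩) (not_le.2 hlt)
  obtain ⟨f, u, v, hf1, huv, hf2⟩ := geometric_hahn_banach_compact_closed himc him hTc hTcl hdisj
  classical
  have hfexp : ∀ y : t → ℝ, f y = ∑ c, y c * f (Pi.single c 1) := by
    intro y
    conv_lhs => rw [pi_eq_sum_univ' y]
    rw [map_sum]
    refine Finset.sum_congr rfl fun c _ => ?_
    rw [map_smul, smul_eq_mul]
  have hfV : v < f (fun _ => V) := hf2 _ (fun c => le_rfl)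
  have hpos : ∀ c : t, 0 ≤ f (Pi.single c 1) := by
    intro c
    by_contra hneg
    push Not at hneg
    set w := f (Pi.single c 1) with hw
    have := hf2 ((fun _ => V) + ((f (fun _ => V) - v) / (-w)) • Pi.single c 1) (by
      intro c'
      simp only [Pi.add_apply, Pi.smul_apply, smul_eq_mul, le_add_iff_nonneg_right]
      refine mul_nonneg (div_nonneg (by linarith) (by linarith)) ?_
      by_cases hcc : c' = c
      · subst hcc; simp
      · simp [hcc])
    rw [map_add, map_smul, ← hw, smul_eq_mul] at this
    have h3 : (f (fun _ => V) - v) / (-w) * w = -(f (fun _ => V) - v) := by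
      rw [div_neg, neg_mul, div_mul_cancel₀ _ hneg.ne]
    rw [h3] at this
    linarith
  set W := ∑ c : t, f (Pi.single c 1) with hW
  have hfVW : f (fun _ => V) = V * W := by
    rw [hfexp, hW, Finset.mul_sum]
  obtain ⟨γ0, hγ0⟩ := hne
  have hWpos : 0 < W := by
    refine lt_of_le_of_ne (Finset.sum_nonneg fun c _ => hpos c) ?_
    intro h0
    have hz : ∀ c : t, f (Pi.single c 1) = 0 := fun c =>
      (Finset.sum_eq_zero_iff_of_nonneg (fun c _ => hpos c)).1 h0.symm c (Finset.mem_univ c)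
    have h1 := hf1 _ ⟨γ0, hγ0, rfl⟩
    rw [hfexp] at h1
    simp only [hz, mul_zero, Finset.sum_const_zero] at h1
    rw [hfVW, ← h0] at hfV
    linarith
  let cb : Z →ᵇ ℝ := ∑ c : t, (f (Pi.single c 1) / W) • c.1.1
  have hcb : cb ∈ C := by
    refine hC.sum_mem (fun c _ => div_nonneg (hpos c) hWpos.le) ?_ (fun c _ => c.1.2)
    rw [← Finset.sum_div, ← hW, div_self hWpos.ne']
  obtain ⟨γ, hγ, hlt⟩ := h cb hcb (u / W) (by
    rw [div_lt_iff₀ hWpos]; linarith)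
  have hint : ∫ z, cb z ∂(γ : Measure Z) = f (Φ γ) / W := by
    rw [hfexp, Finset.sum_div]
    have : ∀ z, cb z = ∑ c : t, (f (Pi.single c 1) / W) * c.1.1 z := by
      intro z
      simp [cb, BoundedContinuousFunction.coe_sum]
    simp_rw [this]
    rw [integral_finsetSum _ (fun c _ => (c.1.1.integrable _).const_mul _)]
    refine Finset.sum_congr rfl fun c _ => ?_
    rw [integral_const_mul]
    simp only [Φ]
    ring
  rw [hint, div_lt_div_iff_of_pos_right hWpos] at hlt
  exact absurd (hf1 _ ⟨γ, hγ, rfl⟩) (not_lt.2 hlt.le)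

def auxS (X : Type*) [MetricSpace X] (ε : ℝ) : Set ((X × ℝ) × (X × ℝ)) :=
  {p : (X × ℝ) × (X × ℝ) | dist p.1.1 p.2.1 ≤ ε ∧ p.1.2 = p.2.2}

def auxGam {X : Type*} [MetricSpace X] [MeasurableSpace X]
    (P : Measure (X × ℝ)) (ε : ℝ) : Set (ProbabilityMeasure ((X × ℝ) × (X × ℝ))) :=
  {γ | (γ : Measure ((X × ℝ) × (X × ℝ))).map Prod.fst = P ∧
    (γ : Measure ((X × ℝ) × (X × ℝ))) (auxS X ε) = 1}

theorem auxS_closed (X : Type*) [MetricSpace X] (ε : ℝ) : IsClosed (auxS X ε) := by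
  unfold auxS
  have h1 : IsClosed {p : (X × ℝ) × (X × ℝ) | dist p.1.1 p.2.1 ≤ ε} :=
    isClosed_le (by fun_prop) continuous_const
  have h2 : IsClosed {p : (X × ℝ) × (X × ℝ) | p.1.2 = p.2.2} :=
    isClosed_eq (by fun_prop) (by fun_prop)
  exact h1.inter h2

theorem auxGam_conv {X : Type*} [MetricSpace X] [MeasurableSpace X]
    (P : Measure (X × ℝ)) (ε : ℝ) : ∀ μ ∈ auxGam P ε, ∀ ν ∈ auxGam P ε, ∀ a b : ℝ, 0 ≤ a → 0 ≤ b →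
      a + b = 1 → ∃ ρ ∈ auxGam P ε,
      (ρ : Measure ((X × ℝ) × (X × ℝ))) = ENNReal.ofReal a • (μ : Measure ((X × ℝ) × (X × ℝ)))
        + ENNReal.ofReal b • (ν : Measure ((X × ℝ) × (X × ℝ))) := by
  intro μ hμ ν hν a b ha hb hab
  have hab' : ENNReal.ofReal a + ENNReal.ofReal b = 1 := by
    rw [← ENNReal.ofReal_add ha hb, hab, ENNReal.ofReal_one]
  refine ⟨⟨ENNReal.ofReal a • (μ : Measure ((X × ℝ) × (X × ℝ)))
        + ENNReal.ofReal b • (ν : Measure ((X × ℝ) × (X × ℝ))), ⟨?_⟩⟩, ⟨?_, ?_⟩, rfl⟩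
  · simp [hab']
  · simp only [ProbabilityMeasure.coe_mk]
    rw [Measure.map_add _ _ measurable_fst, Measure.map_smul, Measure.map_smul, hμ.1, hν.1,
      ← add_smul, hab', one_smul]
  · simp only [ProbabilityMeasure.coe_mk]
    simp [hμ.2, hν.2, hab']

theorem auxGam_compact {X : Type*} [MetricSpace X] [ProperSpace X] [CompleteSpace X]
    [SecondCountableTopology X] [MeasurableSpace X] [BorelSpace X]
    (P : Measure (X × ℝ)) [IsProbabilityMeasure P] (ε : ℝ) :
    IsCompact (auxGam P ε) := by
  have hcl : IsClosed (auxGam P ε) := by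
    have h1 : IsClosed {γ : ProbabilityMeasure ((X × ℝ) × (X × ℝ)) |
        γ.map (f := Prod.fst) measurable_fst.aemeasurable = ⟨P, inferInstance⟩} :=
      isClosed_eq (ProbabilityMeasure.continuous_map continuous_fst) continuous_const
    let d : ((X × ℝ) × (X × ℝ)) →ᵇ ℝ := BoundedContinuousFunction.ofNormedAddCommGroup
      (fun p => min 1 (max (dist p.1.1 p.2.1 - ε) 0 + |p.1.2 - p.2.2|)) (by fun_prop) 1 (by
        intro p
        rw [Real.norm_eq_abs, abs_of_nonneg (by positivity)]
        exact min_le_left _ _)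
    have h2 : IsClosed {γ : ProbabilityMeasure ((X × ℝ) × (X × ℝ)) |
        ∫ z, d z ∂(γ : Measure ((X × ℝ) × (X × ℝ))) = 0} :=
      isClosed_eq (ProbabilityMeasure.continuous_integral_boundedContinuousFunction d)
        continuous_const
    convert h1.inter h2 using 1
    ext γ
    simp only [auxGam, Set.mem_ofPred_eq, mem_inter_iff]
    refine and_congr ?_ ?_
    · exact ⟨fun h => Subtype.ext h, fun h => congrArg Subtype.val h⟩
    · have hd0 : ∀ z, 0 ≤ d z := fun z => by
        change 0 ≤ min 1 _
        positivity
      rw [integral_eq_zero_iff_of_nonneg hd0 (d.integrable _),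
        ← prob_compl_eq_zero_iff (auxS_closed X ε).measurableSet]
      change _ ↔ (γ : Measure ((X × ℝ) × (X × ℝ))) _ = 0
      have : (auxS X ε)ᶜ = {x | d x = (0 : ((X × ℝ) × (X × ℝ)) → ℝ) x}ᶜ := by
        congr 1
        ext z
        simp only [auxS, Set.mem_ofPred_eq, Pi.zero_apply]
        change _ ↔ min 1 (max (dist z.1.1 z.2.1 - ε) 0 + |z.1.2 - z.2.2|) = 0
        constructor
        · rintro ⟨ha, hb⟩
          rw [hb, max_eq_right (by linarith)]
          simp
        · intro h
          have h0 : max (dist z.1.1 z.2.1 - ε) 0 + |z.1.2 - z.2.2| = 0 := by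
            rcases min_choice 1 (max (dist z.1.1 z.2.1 - ε) 0 + |z.1.2 - z.2.2|) with h' | h'
            · rw [h'] at h; norm_num at h
            · rw [h'] at h; exact h
          have h3 := le_max_right (dist z.1.1 z.2.1 - ε) 0
          have h4 := le_max_left (dist z.1.1 z.2.1 - ε) 0
          have h5 := abs_nonneg (z.1.2 - z.2.2)
          refine ⟨by linarith, ?_⟩
          have : |z.1.2 - z.2.2| = 0 := by linarith
          exact sub_eq_zero.1 (abs_eq_zero.1 this)
      rw [this]
  rw [← hcl.closure_eq]
  apply isCompact_closure_of_isTightMeasureSet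
  rw [isTightMeasureSet_iff_exists_isCompact_measure_compl_le]
  intro δ hδ
  have hP : IsTightMeasureSet {P} := isTightMeasureSet_singleton
  rw [isTightMeasureSet_iff_exists_isCompact_measure_compl_le] at hP
  obtain ⟨K, hK, hKδ⟩ := hP δ hδ
  refine ⟨K ×ˢ cthickening ε K, hK.prod hK.cthickening, ?_⟩
  rintro _ ⟨γ, hγ, rfl⟩
  have hsub : (K ×ˢ cthickening ε K)ᶜ ⊆ (Prod.fst ⁻¹' Kᶜ) ∪ (auxS X ε)ᶜ := by
    intro z hz
    by_contra hcon
    simp only [mem_union, mem_preimage, mem_compl_iff, not_or, not_not] at hcon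
    apply hz
    refine ⟨hcon.1, ?_⟩
    apply mem_cthickening_of_dist_le z.2 z.1 ε K hcon.1
    rw [dist_comm, Prod.dist_eq, hcon.2.2]
    simp only [dist_self]
    exact max_le hcon.2.1 (dist_nonneg.trans hcon.2.1)
  refine (measure_mono hsub).trans ((measure_union_le _ _).trans ?_)
  have h0 : (γ : Measure ((X × ℝ) × (X × ℝ))) (auxS X ε)ᶜ = 0 :=
    (prob_compl_eq_zero_iff (auxS_closed X ε).measurableSet).2 hγ.2
  change (γ : Measure ((X × ℝ) × (X × ℝ))) _ + (γ : Measure ((X × ℝ) × (X × ℝ))) _ ≤ _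
  rw [h0, add_zero, ← Measure.map_apply measurable_fst hK.measurableSet.compl, hγ.1]
  exact hKδ P rfl

theorem aux_sel {X : Type*} [MetricSpace X] [SecondCountableTopology X]
    [MeasurableSpace X] [BorelSpace X] [Nonempty X]
    (hmid : ∀ x₁ x₂ : X, ∃ x : X,
      dist x x₁ = dist x₁ x₂ / 2 ∧ dist x x₂ = dist x₁ x₂ / 2)
    (ε : ℝ) (hε : 0 ≤ ε) :
    ∃ s : ℕ → X → X, (∀ n, Measurable (s n)) ∧ (∀ n x, dist x (s n x) ≤ ε) ∧
      ∀ x, closedBall x ε ⊆ closure (range fun n => s n x) := by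
  rcases hε.eq_or_lt with h0 | hpos
  · subst h0
    refine ⟨fun _ x => x, fun _ => measurable_id, fun _ x => by simp, fun x => ?_⟩
    simp
  · classical
    refine ⟨fun n x => if dist x (TopologicalSpace.denseSeq X n) < ε
      then TopologicalSpace.denseSeq X n else x, fun n => ?_, fun n x => ?_, fun x y hy => ?_⟩
    · exact Measurable.ite (measurableSet_lt (by fun_prop) measurable_const)
        measurable_const measurable_id
    · dsimp only
      split_ifs with h
      · exact h.le
      · simpa using hpos.le
    · have h1 : y ∈ closure (ball x ε) := by
        have hk : ∀ k : ℕ, ∃ z, dist z x < ε ∧ dist z x + dist z y ≤ ε ∧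
            dist z y ≤ ε * (1 / 2) ^ k := by
          intro k
          induction k with
          | zero =>
            have : dist x y ≤ ε := by rw [dist_comm]; exact hy
            exact ⟨x, by simpa using hpos, by simpa using this, by simpa using this⟩
          | succ k ih =>
            obtain ⟨z, hz1, hz2, hz3⟩ := ih
            obtain ⟨m, hm1, hm2⟩ := hmid z y
            have := dist_triangle m z x
            refine ⟨m, by linarith, by linarith, ?_⟩
            rw [hm2, pow_succ]
            linarith
        rw [Metric.mem_closure_iff]
        intro r hr
        obtain ⟨k, hk'⟩ := exists_pow_lt_of_lt_one (div_pos hr hpos) (by norm_num : (1/2:ℝ) < 1)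
        obtain ⟨z, hz1, -, hz3⟩ := hk k
        refine ⟨z, hz1, ?_⟩
        rw [dist_comm]
        rw [lt_div_iff₀ hpos] at hk'
        linarith
      have h2 := (TopologicalSpace.denseRange_denseSeq X).open_subset_closure_inter
        (isOpen_ball (x := x) (ε := ε))
      refine closure_minimal (h2.trans (closure_mono ?_)) isClosed_closure h1
      rintro z ⟨hz, n, rfl⟩
      refine ⟨n, ?_⟩
      have : dist x (TopologicalSpace.denseSeq X n) < ε := by rw [dist_comm]; exact hz
      simp [this]

noncomputable def auxcl (y : ℝ) : ℝ := max (-1) (min 1 y)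

noncomputable def auxH {X : Type*} (g : X → ℝ) (p : X × ℝ) : ℝ :=
  1 / 2 + auxcl p.2 * (g p.1 - 1 / 2)

theorem auxcl_cont : Continuous auxcl := by unfold auxcl; fun_prop

theorem auxcl_abs (y : ℝ) : |auxcl y| ≤ 1 :=
  abs_le.2 ⟨le_max_left _ _, max_le (by norm_num) (min_le_left _ _)⟩

theorem auxH_one {X : Type*} (g : X → ℝ) (x : X) : auxH g (x, 1) = g x := by
  simp [auxH, auxcl]

theorem auxH_neg {X : Type*} (g : X → ℝ) (x : X) : auxH g (x, -1) = 1 - g x := by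
  simp [auxH, auxcl]; ring

theorem auxH_sub {X : Type*} (g g' : X → ℝ) (p : X × ℝ) :
    |auxH g p - auxH g' p| ≤ |g p.1 - g' p.1| := by
  have : auxH g p - auxH g' p = auxcl p.2 * (g p.1 - g' p.1) := by unfold auxH; ring
  rw [this, abs_mul]
  exact mul_le_of_le_one_left (abs_nonneg _) (auxcl_abs _)

theorem auxH_mem {X : Type*} (g : X → ℝ) (hg : ∀ x, 0 ≤ g x ∧ g x ≤ 1) (p : X × ℝ) :
    0 ≤ auxH g p ∧ auxH g p ≤ 1 := by
  have h1 : |auxcl p.2 * (g p.1 - 1 / 2)| ≤ 1 / 2 := by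
    rw [abs_mul]
    have : |g p.1 - 1 / 2| ≤ 1 / 2 := abs_le.2 ⟨by linarith [(hg p.1).1], by linarith [(hg p.1).2]⟩
    exact (mul_le_of_le_one_left (abs_nonneg _) (auxcl_abs _)).trans this
  have := abs_le.1 h1
  unfold auxH
  constructor <;> linarith

theorem auxH_cont {X : Type*} [TopologicalSpace X] (g : X → ℝ) (hg : Continuous g) :
    Continuous (auxH g) := by
  unfold auxH
  have := auxcl_cont
  fun_prop

theorem auxH_meas {X : Type*} [MeasurableSpace X] (g : X → ℝ) (hg : Measurable g) :
    Measurable (auxH g) := by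
  unfold auxH
  have := auxcl_cont.measurable
  fun_prop

theorem aux_integrable {Z : Type*} [MeasurableSpace Z] (μ : Measure Z) [IsFiniteMeasure μ]
    (F : Z → ℝ) (hF : Measurable F) (h : ∀ z, 0 ≤ F z ∧ F z ≤ 1) : Integrable F μ :=
  Integrable.of_bound hF.aestronglyMeasurable 1 (Eventually.of_forall fun z => by
    rw [Real.norm_eq_abs, abs_of_nonneg (h z).1]; exact (h z).2)

theorem aux_E1 {X : Type*} [MetricSpace X] [SecondCountableTopology X]
    [MeasurableSpace X] [BorelSpace X] [Nonempty X]
    (hmid : ∀ x₁ x₂ : X, ∃ x : X,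
      dist x x₁ = dist x₁ x₂ / 2 ∧ dist x x₂ = dist x₁ x₂ / 2)
    (ε : ℝ) (hε : 0 ≤ ε) (P : Measure (X × ℝ)) [IsProbabilityMeasure P]
    (g : X → ℝ) (hgc : Continuous g) (hg : ∀ x, 0 ≤ g x ∧ g x ≤ 1) :
    ∃ F : X × ℝ → ℝ, Measurable F ∧ (∀ p, 0 ≤ F p ∧ F p ≤ 1) ∧
      (∀ p x', dist p.1 x' ≤ ε → auxH g (x', p.2) ≤ F p) ∧
      ∀ δ > (0:ℝ), ∃ γ ∈ auxGam P ε, ∫ p, F p ∂P - δ ≤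
        ∫ z, auxH g z.2 ∂(γ : Measure ((X × ℝ) × (X × ℝ))) := by
  obtain ⟨s, hs, hsd, hscl⟩ := aux_sel hmid ε hε
  have hHc := auxH_cont g hgc
  have hHm := auxH_mem g hg
  have hbdd : ∀ p : X × ℝ, BddAbove (range fun n => auxH g (s n p.1, p.2)) := fun p =>
    ⟨1, by rintro _ ⟨n, rfl⟩; exact (hHm _).2⟩
  have hum : ∀ n, Measurable fun p : X × ℝ => auxH g (s n p.1, p.2) := fun n =>
    hHc.measurable.comp (((hs n).comp measurable_fst).prodMk measurable_snd)
  have hFm : Measurable fun p : X × ℝ => ⨆ n, auxH g (s n p.1, p.2) := Measurable.iSup hum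
  have hF01 : ∀ p : X × ℝ, 0 ≤ (⨆ n, auxH g (s n p.1, p.2)) ∧
      (⨆ n, auxH g (s n p.1, p.2)) ≤ 1 := fun p =>
    ⟨(hHm _).1.trans (le_ciSup (hbdd p) 0), ciSup_le fun n => (hHm _).2⟩
  refine ⟨fun p => ⨆ n, auxH g (s n p.1, p.2), hFm, hF01, ?_, ?_⟩
  · intro p x' hx'
    have hc : IsClosed {x'' : X | auxH g (x'', p.2) ≤ ⨆ n, auxH g (s n p.1, p.2)} :=
      isClosed_le (by fun_prop) continuous_const
    refine closure_minimal ?_ hc (hscl p.1 (by rw [mem_closedBall, dist_comm]; exact hx'))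
    rintro _ ⟨n, rfl⟩
    exact le_ciSup (hbdd p) n
  · intro δ hδ
    classical
    have hex : ∀ p : X × ℝ, ∃ n, (⨆ n, auxH g (s n p.1, p.2)) - δ < auxH g (s n p.1, p.2) :=
      fun p => exists_lt_of_lt_ciSup (by linarith)
    have hT : Measurable fun p : X × ℝ => s (Nat.find (hex p)) p.1 :=
      Measurable.find (f := fun n (p : X × ℝ) => s n p.1) (fun n => (hs n).comp measurable_fst)
        (fun n => measurableSet_lt (hFm.sub measurable_const) (hum n)) hex
    have hT2 : Measurable fun p : X × ℝ => (p, ((s (Nat.find (hex p)) p.1, p.2) : X × ℝ)) :=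
      measurable_id.prodMk (hT.prodMk measurable_snd)
    have hpm : IsProbabilityMeasure
        (P.map fun p : X × ℝ => (p, ((s (Nat.find (hex p)) p.1, p.2) : X × ℝ))) :=
      Measure.isProbabilityMeasure_map hT2.aemeasurable
    refine ⟨⟨P.map fun p : X × ℝ => (p, ((s (Nat.find (hex p)) p.1, p.2) : X × ℝ)), hpm⟩,
      ⟨?_, ?_⟩, ?_⟩
    · rw [ProbabilityMeasure.coe_mk, Measure.map_map measurable_fst hT2]
      exact Measure.map_id
    · rw [ProbabilityMeasure.coe_mk, Measure.map_apply hT2 (auxS_closed X ε).measurableSet]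
      convert measure_univ (μ := P)
      ext p
      simp [auxS, hsd]
    · rw [ProbabilityMeasure.coe_mk, integral_map (f := fun z : (X × ℝ) × (X × ℝ) => auxH g z.2)
        hT2.aemeasurable (hHc.comp continuous_snd).aestronglyMeasurable]
      have hi1 := aux_integrable P _ hFm hF01
      have : ∫ p, (⨆ n, auxH g (s n p.1, p.2)) ∂P - δ
          = ∫ p, ((⨆ n, auxH g (s n p.1, p.2)) - δ) ∂P := by
        rw [integral_sub hi1 (integrable_const _)]; simp
      rw [this]
      refine integral_mono (hi1.sub (integrable_const _)) ?_ ?_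
      · exact aux_integrable P _ (hHc.measurable.comp (hT.prodMk measurable_snd)) fun p => hHm _
      · intro p
        exact (Nat.find_spec (hex p)).le

noncomputable def auxG {X : Type*} (F : X × ℝ → ℝ) (t : ℝ) (p : X × ℝ) : ℝ :=
  if (p.2 = 1 ∧ t < F p) ∨ (p.2 = -1 ∧ 1 - t ≤ F p) then 1 else 0

theorem auxG_mem {X : Type*} (F : X × ℝ → ℝ) (t : ℝ) (p : X × ℝ) :
    0 ≤ auxG F t p ∧ auxG F t p ≤ 1 := by
  unfold auxG; split_ifs <;> norm_num

theorem auxG_meas {X : Type*} [MeasurableSpace X] (F : X × ℝ → ℝ) (hF : Measurable F) :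
    Measurable fun z : ℝ × (X × ℝ) => auxG F z.1 z.2 := by
  unfold auxG
  have hF2 : Measurable fun z : ℝ × (X × ℝ) => F z.2 := hF.comp measurable_snd
  have hy : Measurable fun z : ℝ × (X × ℝ) => z.2.2 := by fun_prop
  refine Measurable.ite (MeasurableSet.union ?_ ?_) measurable_const measurable_const
  · exact (hy (measurableSet_singleton 1)).inter (measurableSet_lt measurable_fst hF2)
  · exact (hy (measurableSet_singleton (-1))).inter
      (measurableSet_le (measurable_const.sub measurable_fst) hF2)

theorem auxG_inner {X : Type*} (F : X × ℝ → ℝ) (hF : ∀ p, 0 ≤ F p ∧ F p ≤ 1) (p : X × ℝ)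
    (hp : p.2 = 1 ∨ p.2 = -1) : ∫ t in Ioc (0:ℝ) 1, auxG F t p = F p := by
  rcases hp with hp | hp
  · have : ∀ t, auxG F t p = (Iio (F p)).indicator (fun _ => (1:ℝ)) t := by
      intro t
      simp only [auxG, hp, indicator, mem_Iio]
      norm_num
    simp_rw [this]
    rw [integral_indicator measurableSet_Iio, setIntegral_const,
      measureReal_restrict_apply measurableSet_Iio]
    have : Iio (F p) ∩ Ioc 0 1 = Ioo 0 (F p) := by
      ext t
      simp only [mem_inter_iff, mem_Iio, mem_Ioc, mem_Ioo]
      constructor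
      · rintro ⟨a, b, c⟩; exact ⟨b, a⟩
      · rintro ⟨a, b⟩; exact ⟨b, a, by linarith [(hF p).2]⟩
    simp [this, (hF p).1]
  · have : ∀ t, auxG F t p = (Ici (1 - F p)).indicator (fun _ => (1:ℝ)) t := by
      intro t
      simp only [auxG, hp, indicator, mem_Ici]
      have : (1 - t ≤ F p) ↔ (1 - F p ≤ t) := by constructor <;> intro h <;> linarith
      norm_num [this]
    simp_rw [this]
    rw [integral_indicator measurableSet_Ici, setIntegral_const,
      measureReal_restrict_apply measurableSet_Ici]
    have h1 : (Ici (1 - F p) ∩ Ioc 0 1 : Set ℝ) ⊆ Icc (1 - F p) 1 := by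
      rintro t ⟨a, b, c⟩; exact ⟨a, c⟩
    have h2 : Ioc (1 - F p) 1 ⊆ (Ici (1 - F p) ∩ Ioc 0 1 : Set ℝ) := by
      rintro t ⟨a, b⟩; exact ⟨a.le, by linarith [(hF p).2], b⟩
    have h3 : volume (Ici (1 - F p) ∩ Ioc 0 1 : Set ℝ) = ENNReal.ofReal (F p) := by
      apply le_antisymm
      · refine (measure_mono h1).trans ?_
        simp
      · refine le_trans ?_ (measure_mono h2)
        simp
    simp [Measure.real, h3, (hF p).1]

theorem aux_E2 {X : Type*} [MeasurableSpace X] (P : Measure (X × ℝ)) [IsProbabilityMeasure P]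
    (hlab : ∀ᵐ p ∂P, p.2 = 1 ∨ p.2 = -1)
    (F : X × ℝ → ℝ) (hFm : Measurable F) (hF : ∀ p, 0 ≤ F p ∧ F p ≤ 1) :
    ∃ t, ∫ p, auxG F t p ∂P ≤ ∫ p, F p ∂P := by
  have hpm : IsProbabilityMeasure (volume.restrict (Ioc (0:ℝ) 1)) := ⟨by simp⟩
  have hint : Integrable (Function.uncurry fun t p => auxG F t p)
      ((volume.restrict (Ioc (0:ℝ) 1)).prod P) :=
    aux_integrable _ _ (auxG_meas F hFm) fun z => auxG_mem F z.1 z.2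
  obtain ⟨t, ht⟩ := exists_le_integral (μ := volume.restrict (Ioc (0:ℝ) 1))
    (f := fun t => ∫ p, auxG F t p ∂P) hint.integral_prod_left
  refine ⟨t, ht.trans (le_of_eq ?_)⟩
  rw [integral_integral_swap hint]
  refine integral_congr_ae ?_
  filter_upwards [hlab] with p hp
  exact auxG_inner F hF p hp

theorem stmt17 {X : Type*} [MetricSpace X] [ProperSpace X] [CompleteSpace X]
    [SecondCountableTopology X] [MeasurableSpace X] [BorelSpace X]
    (hmid : ∀ x₁ x₂ : X, ∃ x : X,
      dist x x₁ = dist x₁ x₂ / 2 ∧ dist x x₂ = dist x₁ x₂ / 2)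
    (ε : ℝ) (hε : 0 ≤ ε)
    (P : Measure (X × ℝ)) [IsProbabilityMeasure P]
    (hlabels : P {p : X × ℝ | p.2 = 1 ∨ p.2 = -1} = 1)
    (lam τ : ℝ) (hlam : 0 ≤ lam) (hτ : 0 ≤ τ)
    (ψ : ℝ → ℝ) (hcont : Continuous ψ) (hdec : Antitone ψ)
    (hodd : ∀ α, ψ (-α) = -ψ α)
    (hstrict : ∃ ρ > (0:ℝ), StrictAntiOn ψ (Icc (-ρ) ρ))
    (hlb : ∀ α, -lam ≤ ψ α)
    (φ : ℝ → ℝ) (hφ : ∀ α, φ α = lam + ψ (α - τ))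
    (hlim1 : Tendsto φ atBot (nhds 1)) (hlim0 : Tendsto φ atTop (nhds 0)) :
    (⨅ f : {f : X → ℝ // Measurable f}, ⨆ Q : advSet P ε, stdRisk (margin φ) Q.1 f.1) =
      (⨆ Q : advSet P ε, ⨅ f : {f : X → ℝ // Measurable f}, stdRisk (margin φ) Q.1 f.1) ∧
    ∃ Qs ∈ advSet P ε,
      (⨅ f : {f : X → ℝ // Measurable f}, stdRisk (margin φ) Qs f.1) =
        ⨆ Q : advSet P ε, ⨅ f : {f : X → ℝ // Measurable f}, stdRisk (margin φ) Q.1 f.1 := by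
  classical
  have hX : Nonempty X := by
    obtain ⟨p⟩ := P.nonempty_of_neZero
    exact ⟨p.1⟩
  have hanti : Antitone φ := by
    intro a b hab
    rw [hφ, hφ]
    have := hdec (sub_le_sub_right hab τ)
    linarith
  have h01 : ∀ α, 0 ≤ φ α ∧ φ α ≤ 1 := fun α =>
    ⟨hanti.le_of_tendsto hlim0 α, hanti.ge_of_tendsto hlim1 α⟩
  have hφc : Continuous φ := by
    have : φ = fun α => lam + ψ (α - τ) := funext hφ
    rw [this]
    fun_prop
  have hsum2 : ∀ β, φ (τ + β) + φ (τ - β) = 2 * lam := by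
    intro β
    rw [hφ, hφ]
    have h1 : τ + β - τ = β := by ring
    have h2 : τ - β - τ = -β := by ring
    rw [h1, h2, hodd]
    ring
  have hlam2 : 2 * lam = 1 := by
    have h1 : Tendsto (fun β => φ (τ + β)) atTop (nhds 0) :=
      hlim0.comp (tendsto_atTop_add_const_left _ _ tendsto_id)
    have h2 : Tendsto (fun β => φ (τ - β)) atTop (nhds 1) := by
      refine hlim1.comp (show Tendsto (fun β => τ - β) atTop atBot from ?_)
      simp only [sub_eq_add_neg]
      exact tendsto_atBot_add_const_left _ _ tendsto_neg_atTop_atBot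
    have h3 := h1.add h2
    simp only [hsum2, zero_add] at h3
    exact tendsto_nhds_unique tendsto_const_nhds h3
  have hsum : ∀ α, 1 ≤ φ α + φ (-α) := by
    intro α
    have h1 := hsum2 (α - τ)
    rw [hlam2] at h1
    have h2 : τ + (α - τ) = α := by ring
    rw [h2] at h1
    have h3 : φ (τ - (α - τ)) ≤ φ (-α) := hanti (by linarith)
    linarith
  have hlab : ∀ᵐ p ∂P, p.2 = 1 ∨ p.2 = -1 := by
    have hm : MeasurableSet {p : X × ℝ | p.2 = 1 ∨ p.2 = -1} :=
      (measurable_snd (measurableSet_singleton (1:ℝ))).union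
        (measurable_snd (measurableSet_singleton (-1:ℝ)))
    exact (prob_compl_eq_zero_iff hm).2 hlabels
  have hintegrand : ∀ f : X → ℝ, Measurable f →
      Measurable fun p : X × ℝ => φ (p.2 * f p.1) := fun f hf =>
    hφc.measurable.comp (measurable_snd.mul (hf.comp measurable_fst))
  have hrisk : ∀ Q ∈ advSet P ε, ∀ f : X → ℝ, Measurable f →
      0 ≤ stdRisk (margin φ) Q f ∧ stdRisk (margin φ) Q f ≤ 1 := by
    intro Q hQ f hf
    have := hQ.1
    refine ⟨integral_nonneg fun p => (h01 _).1, ?_⟩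
    have h1 : ∫ p, φ (p.2 * f p.1) ∂Q ≤ ∫ _, (1:ℝ) ∂Q :=
      integral_mono (aux_integrable Q _ (hintegrand f hf) fun p => h01 _) (integrable_const _)
        fun p => (h01 _).2
    rw [integral_const, probReal_univ, one_smul] at h1
    exact h1
  have hbddQ : ∀ f : {f : X → ℝ // Measurable f},
      BddAbove (range fun Q : advSet P ε => stdRisk (margin φ) Q.1 f.1) := fun f =>
    ⟨1, by rintro _ ⟨Q, rfl⟩; exact (hrisk Q.1 Q.2 f.1 f.2).2⟩
  have hbddf : ∀ Q : advSet P ε,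
      BddBelow (range fun f : {f : X → ℝ // Measurable f} => stdRisk (margin φ) Q.1 f.1) := fun Q =>
    ⟨0, by rintro _ ⟨f, rfl⟩; exact (hrisk Q.1 Q.2 f.1 f.2).1⟩
  have hmemA : ∀ γ ∈ auxGam P ε,
      (γ : Measure ((X × ℝ) × (X × ℝ))).map Prod.snd ∈ advSet P ε := fun γ hγ =>
    ⟨Measure.isProbabilityMeasure_map measurable_snd.aemeasurable, γ, inferInstance, hγ.1, rfl, hγ.2⟩
  obtain ⟨F0, -, -, -, hne0⟩ := aux_E1 hmid ε hε P (fun _ => 0) continuous_const (by simp)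
  obtain ⟨γ0, hγ0, -⟩ := hne0 1 one_pos
  have hneA : Nonempty (advSet P ε) := ⟨⟨_, hmemA γ0 hγ0⟩⟩
  have hnef : Nonempty {f : X → ℝ // Measurable f} := ⟨⟨fun _ => 0, measurable_const⟩⟩
  set V := ⨅ f : {f : X → ℝ // Measurable f}, ⨆ Q : advSet P ε, stdRisk (margin φ) Q.1 f.1 with hV
  have hbddV : BddBelow (range fun f : {f : X → ℝ // Measurable f} =>
      ⨆ Q : advSet P ε, stdRisk (margin φ) Q.1 f.1) :=
    ⟨0, by
      rintro _ ⟨f, rfl⟩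
      exact Real.iSup_nonneg fun Q => (hrisk Q.1 Q.2 f.1 f.2).1⟩
  -- the primal upper bound
  have hE : ∀ g : X → ℝ, Continuous g → (∀ x, 0 ≤ g x ∧ g x ≤ 1) → ∀ v < V,
      ∃ γ ∈ auxGam P ε, v < ∫ z, auxH g z.2 ∂(γ : Measure ((X × ℝ) × (X × ℝ))) := by
    intro g hgc hg v hv
    obtain ⟨F, hFm, hF01, hFub, hFγ⟩ := aux_E1 hmid ε hε P g hgc hg
    obtain ⟨t, ht⟩ := aux_E2 P hlab F hFm hF01
    obtain ⟨γ, hγ, hle⟩ := hFγ ((V - v) / 3) (by linarith)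
    refine ⟨γ, hγ, ?_⟩
    obtain ⟨M, hM⟩ := (hlim0.eventually (gt_mem_nhds (show (0:ℝ) < (V - v) / 3 by linarith))).exists
    have hfm : Measurable fun x => if t < g x then -M else M :=
      Measurable.ite (measurableSet_lt measurable_const hgc.measurable)
        measurable_const measurable_const
    have h1 : V ≤ φ M + ∫ p, auxG F t p ∂P := by
      refine (ciInf_le hbddV ⟨_, hfm⟩).trans (ciSup_le ?_)
      rintro ⟨Q, hQp, γ', hγp, hγ1, hγ2, hγS⟩
      change ∫ p : X × ℝ, φ (p.2 * (if t < g p.1 then -M else M)) ∂Q ≤ _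
      have hGm : Measurable (auxG F t) :=
        (auxG_meas F hFm).comp (measurable_const.prodMk measurable_id)
      have hφm := hintegrand _ hfm
      rw [← hγ2, ← hγ1, integral_map measurable_snd.aemeasurable hφm.aestronglyMeasurable,
        integral_map measurable_fst.aemeasurable hGm.aestronglyMeasurable]
      have hi2 := aux_integrable γ' (fun z => auxG F t z.1) (hGm.comp measurable_fst)
        fun z => auxG_mem F t z.1
      have h2 : φ M + ∫ z, auxG F t z.1 ∂γ' = ∫ z, (φ M + auxG F t z.1) ∂γ' := by
        rw [integral_add (integrable_const _) hi2]; simp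
      rw [h2]
      refine integral_mono_ae (aux_integrable γ' _ (hφm.comp measurable_snd) fun z => h01 _)
        ((integrable_const _).add hi2) ?_
      have hlab' : ∀ᵐ z ∂γ', z.1.2 = 1 ∨ z.1.2 = -1 := by
        rw [← hγ1] at hlab
        exact ae_of_ae_map measurable_fst.aemeasurable hlab
      have hS' : ∀ᵐ z ∂γ', z ∈ auxS X ε :=
        (prob_compl_eq_zero_iff (auxS_closed X ε).measurableSet).2 hγS
      filter_upwards [hlab', hS'] with z hz hzS
      have hub := hFub z.1 z.2.1 hzS.1
      have hG0 := (auxG_mem F t z.1).1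
      have hM0 := (h01 M).1
      change φ (z.2.2 * (if t < g z.2.1 then -M else M)) ≤ φ M + auxG F t z.1
      rw [← hzS.2]
      rcases hz with hz | hz
      · rw [hz, auxH_one] at hub
        rw [hz]
        split_ifs with hlt
        · have : auxG F t z.1 = 1 := if_pos (Or.inl ⟨hz, by linarith⟩)
          rw [this]
          linarith [(h01 (1 * -M)).2]
        · rw [one_mul]; linarith
      · rw [hz, auxH_neg] at hub
        rw [hz]
        split_ifs with hlt
        · have : (-1:ℝ) * -M = M := by ring
          rw [this]; linarith
        · have : auxG F t z.1 = 1 := if_pos (Or.inr ⟨hz, by linarith⟩)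
          rw [this]
          linarith [(h01 (-1 * M)).2]
    linarith
  -- minimax
  obtain ⟨γ, hγ, hγV⟩ := aux_minimax (auxGam P ε) (auxGam_compact P ε) ⟨γ0, hγ0⟩
    (auxGam_conv P ε)
    {c | ∃ g : X → ℝ, Continuous g ∧ (∀ x, 0 ≤ g x ∧ g x ≤ 1) ∧ ∀ z, c z = auxH g z.2}
    (by
      rintro c ⟨g, hgc, hg, hc⟩ c' ⟨g', hgc', hg', hc'⟩ a b ha hb hab
      refine ⟨fun x => a * g x + b * g' x, by fun_prop, fun x => ⟨?_, ?_⟩, fun z => ?_⟩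
      · have := mul_nonneg ha (hg x).1
        have := mul_nonneg hb (hg' x).1
        linarith
      · have := mul_le_mul_of_nonneg_left (hg x).2 ha
        have := mul_le_mul_of_nonneg_left (hg' x).2 hb
        linarith
      · simp only [BoundedContinuousFunction.coe_add, BoundedContinuousFunction.coe_smul,
          Pi.add_apply, smul_eq_mul, hc, hc', auxH]
        have : b = 1 - a := by linarith
        subst this
        ring)
    V (by
      rintro c ⟨g, hgc, hg, hc⟩ v hv
      simp only [hc]
      exact hE g hgc hg v hv)
  have hQmem := hmemA γ hγ
  set Qs := (γ : Measure ((X × ℝ) × (X × ℝ))).map Prod.snd with hQs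
  have hQp : IsProbabilityMeasure Qs := hQmem.1
  have hQlab : ∀ᵐ p ∂Qs, p.2 = 1 ∨ p.2 = -1 := by
    have hm : MeasurableSet {p : X × ℝ | p.2 = 1 ∨ p.2 = -1} :=
      (measurable_snd (measurableSet_singleton (1:ℝ))).union
        (measurable_snd (measurableSet_singleton (-1:ℝ)))
    rw [hQs, ae_map_iff measurable_snd.aemeasurable hm]
    have hlab' : ∀ᵐ z ∂(γ : Measure ((X × ℝ) × (X × ℝ))), z.1.2 = 1 ∨ z.1.2 = -1 := by
      rw [← hγ.1] at hlab
      exact ae_of_ae_map measurable_fst.aemeasurable hlab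
    have hS' : ∀ᵐ z ∂(γ : Measure ((X × ℝ) × (X × ℝ))), z ∈ auxS X ε :=
      (prob_compl_eq_zero_iff (auxS_closed X ε).measurableSet).2 hγ.2
    filter_upwards [hlab', hS'] with z hz hzS
    rw [← hzS.2]
    exact hz
  have hdual : ∀ f : X → ℝ, Measurable f → V ≤ stdRisk (margin φ) Qs f := by
    intro f hf
    refine le_of_forall_pos_le_add fun δ hδ => ?_
    have hgm : Measurable fun x => φ (f x) := hφc.measurable.comp hf
    have hpm : IsProbabilityMeasure (Qs.map Prod.fst) :=
      Measure.isProbabilityMeasure_map measurable_fst.aemeasurable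
    obtain ⟨g0, hg0, hg0i⟩ := (aux_integrable (Qs.map Prod.fst) _ hgm
      fun x => h01 _).exists_boundedContinuous_integral_sub_le hδ
    let g' : X → ℝ := fun x => max 0 (min 1 (g0 x))
    have hg'c : Continuous g' := by
      have := g0.continuous
      fun_prop
    have hg' : ∀ x, 0 ≤ g' x ∧ g' x ≤ 1 := fun x =>
      ⟨le_max_left _ _, max_le zero_le_one (min_le_left _ _)⟩
    have hclamp : ∀ x, |φ (f x) - g' x| ≤ |φ (f x) - g0 x| := by
      intro x
      have h1 : φ (f x) = max 0 (min 1 (φ (f x))) := by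
        rw [min_eq_right (h01 _).2, max_eq_right (h01 _).1]
      conv_lhs => rw [h1]
      refine (abs_max_sub_max_le_max _ _ _ _).trans (max_le (by simp) ?_)
      exact (abs_min_sub_min_le_max _ _ _ _).trans (max_le (by simp) le_rfl)
    have hHi := aux_integrable Qs _ (auxH_meas g' hg'c.measurable) (auxH_mem g' hg')
    have hHi2 := aux_integrable Qs _ (auxH_meas _ hgm) (auxH_mem (fun x => φ (f x)) fun x => h01 _)
    have h1 : V ≤ ∫ p, auxH g' p ∂Qs := by
      let c : ((X × ℝ) × (X × ℝ)) →ᵇ ℝ := BoundedContinuousFunction.ofNormedAddCommGroup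
        (fun z => auxH g' z.2) ((auxH_cont g' hg'c).comp continuous_snd) 1 (by
          intro z
          rw [Real.norm_eq_abs, abs_of_nonneg (auxH_mem g' hg' _).1]
          exact (auxH_mem g' hg' _).2)
      rw [hQs, integral_map measurable_snd.aemeasurable
        (auxH_cont g' hg'c).aestronglyMeasurable]
      exact hγV c ⟨g', hg'c, hg', fun z => rfl⟩
    have habs : Integrable (fun x => |φ (f x) - g0 x|) (Qs.map Prod.fst) :=
      ((aux_integrable (Qs.map Prod.fst) _ hgm fun x => h01 _).sub hg0i).abs
    have habs2 : Integrable (fun p : X × ℝ => |φ (f p.1) - g0 p.1|) Qs :=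
      habs.comp_measurable measurable_fst
    have h2 : ∫ p : X × ℝ, |φ (f p.1) - g0 p.1| ∂Qs ≤ δ := by
      rw [integral_map measurable_fst.aemeasurable (by
        exact ((aux_integrable (Qs.map Prod.fst) _ hgm fun x => h01 _).sub
          hg0i).norm.aestronglyMeasurable)] at hg0
      exact hg0
    have h3 : ∫ p, auxH g' p ∂Qs ≤
        ∫ p : X × ℝ, (auxH (fun x => φ (f x)) p + |φ (f p.1) - g0 p.1|) ∂Qs := by
      refine integral_mono hHi (hHi2.add habs2) fun p => ?_
      have ha := (auxH_sub (fun x => φ (f x)) g' p).trans (hclamp p.1)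
      have := (abs_le.1 ha).1
      dsimp only
      linarith
    rw [integral_add hHi2 habs2] at h3
    have h4 : ∫ p, auxH (fun x => φ (f x)) p ∂Qs ≤ stdRisk (margin φ) Qs f := by
      refine integral_mono_ae hHi2 (aux_integrable Qs _ (hintegrand f hf) fun p => h01 _) ?_
      filter_upwards [hQlab] with p hp
      obtain ⟨x, y⟩ := p
      change auxH _ _ ≤ φ (y * f x)
      rcases hp with hp | hp
      · change y = 1 at hp
        subst hp
        rw [auxH_one, one_mul]
      · change y = -1 at hp
        subst hp
        rw [auxH_neg, neg_one_mul]
        linarith [hsum (f x)]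
    linarith
  have hbddS : BddAbove (range fun Q : advSet P ε =>
      ⨅ f : {f : X → ℝ // Measurable f}, stdRisk (margin φ) Q.1 f.1) :=
    ⟨1, by
      rintro _ ⟨Q, rfl⟩
      exact (ciInf_le (hbddf Q) ⟨fun _ => 0, measurable_const⟩).trans
        (hrisk Q.1 Q.2 _ measurable_const).2⟩
  have hweak : (⨆ Q : advSet P ε, ⨅ f : {f : X → ℝ // Measurable f},
      stdRisk (margin φ) Q.1 f.1) ≤ V :=
    ciSup_le fun Q => le_ciInf fun f => (ciInf_le (hbddf Q) f).trans (le_ciSup (hbddQ f) Q)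
  have hA : V ≤ ⨅ f : {f : X → ℝ // Measurable f}, stdRisk (margin φ) Qs f.1 :=
    le_ciInf fun f => hdual f.1 f.2
  have hB : (⨅ f : {f : X → ℝ // Measurable f}, stdRisk (margin φ) Qs f.1) ≤
      ⨆ Q : advSet P ε, ⨅ f : {f : X → ℝ // Measurable f}, stdRisk (margin φ) Q.1 f.1 :=
    le_ciSup hbddS ⟨Qs, hQmem⟩
  exact ⟨le_antisymm (hA.trans hB) hweak, Qs, hQmem, le_antisymm hB (hweak.trans hA)⟩
end

section
/- Let X be a proper Polish space with the midpoint property, ε ≥ 0, P Borel on X × {−1,+1}, φ a 0/1-like margin loss, and Q* ∈ A_ε(P) an optimal attack (maximizer of Q ↦ inf_f R_Q(f) over A_ε(P)). If (f_n) is a sequence of measurable functions with R_{φ_ε,P}(f_n) → R*_{φ_ε,P}, then R_{Q*}(f_n) → R*_{ε,P}. -/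
open MeasureTheory Metric Filter Set

lemma analytic_inner {Y : Type*} [MetricSpace Y] [MeasurableSpace Y] [BorelSpace Y]
    (μ : Measure Y) [IsFiniteMeasure μ] (A : Set Y) (hA : AnalyticSet A)
    (c : ENNReal) (hc : c < μ A) : ∃ K, K ⊆ A ∧ IsCompact K ∧ c ≤ μ K := by
  rw [AnalyticSet] at hA
  rcases hA with rfl | ⟨g, hg, rfl⟩
  · simp at hc
  have step : ∀ (B : {B : Set (ℕ → ℕ) // c < μ (g '' B)}) (k : ℕ), ∃ m : ℕ,
      c < μ (g '' (B.1 ∩ {σ | σ k ≤ m})) := by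
    rintro ⟨B, hB⟩ k
    have h1 : g '' B = ⋃ m : ℕ, g '' (B ∩ {σ | σ k ≤ m}) := by
      rw [← image_iUnion, ← inter_iUnion]
      congr 1
      ext σ
      simp only [mem_inter_iff, mem_iUnion, mem_ofPred_eq]
      exact ⟨fun h => ⟨h, σ k, le_rfl⟩, fun h => h.1⟩
    have h2 : Monotone (fun m : ℕ => g '' (B ∩ {σ | σ k ≤ m})) := by
      intro a b hab
      apply image_mono
      rintro σ ⟨h, h'⟩
      exact ⟨h, le_trans h' hab⟩
    rw [h1, h2.measure_iUnion] at hB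
    exact lt_iSup_iff.1 hB
  choose m hm using step
  let S : ℕ → {B : Set (ℕ → ℕ) // c < μ (g '' B)} := fun k => Nat.rec
    ⟨univ, by simpa using hc⟩ (fun k B => ⟨B.1 ∩ {σ | σ k ≤ m B k}, hm B k⟩) k
  let n : ℕ → ℕ := fun k => m (S k) k
  have hS : ∀ k, (S k).1 = {σ | ∀ i < k, σ i ≤ n i} := by
    intro k
    induction k with
    | zero => simp [S]
    | succ k ih =>
      have : (S (k+1)).1 = (S k).1 ∩ {σ | σ k ≤ n k} := rfl
      rw [this, ih]
      ext σ
      simp only [mem_inter_iff, mem_ofPred_eq, Nat.lt_succ_iff]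
      constructor
      · rintro ⟨h1, h2⟩ i hi
        rcases hi.lt_or_eq with h | rfl
        · exact h1 i h
        · exact h2
      · intro h
        exact ⟨fun i hi => h i hi.le, h k le_rfl⟩
  have hK : IsCompact (Set.pi univ (fun k => Iic (n k)) : Set (ℕ → ℕ)) :=
    isCompact_univ_pi fun k => (finite_Iic (n k)).isCompact
  refine ⟨g '' (Set.pi univ (fun k => Iic (n k))), image_subset_range _ _, hK.image hg, ?_⟩
  rw [Set.measure_eq_iInf_isOpen]
  refine le_iInf₂ fun U hU => le_iInf fun hUo => ?_
  by_contra hcon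
  push Not at hcon
  have hne : ∀ k, ∃ σ ∈ (S k).1, g σ ∉ U := by
    intro k
    by_contra h
    push Not at h
    have : μ (g '' (S k).1) ≤ μ U := measure_mono (image_subset_iff.2 h)
    exact absurd ((S k).2.trans_le this) (not_lt.2 hcon.le)
  choose σ hσ hσU using hne
  obtain ⟨τ, hτ, u, hu, hlim⟩ := hK.tendsto_subseq (x := fun k i => min (σ k i) (n i))
    (fun k i _ => mem_Iic.2 (min_le_right _ _))
  have hlim2 : Tendsto (σ ∘ u) atTop (nhds τ) := by
    rw [tendsto_pi_nhds] at hlim ⊢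
    intro i
    refine (hlim i).congr' ?_
    filter_upwards [eventually_gt_atTop i] with k hk
    have h3 := hσ (u k)
    rw [hS] at h3
    exact min_eq_left (h3 i (hk.trans_le (hu.id_le k)))
  have h4 : ∀ᶠ k in atTop, g (σ (u k)) ∈ U :=
    ((hg.tendsto τ).comp hlim2).eventually (hUo.mem_nhds (hU (mem_image_of_mem _ hτ)))
  obtain ⟨k, hk⟩ := h4.exists
  exact hσU _ hk

lemma analytic_null {Y : Type*} [MetricSpace Y] [MeasurableSpace Y] [BorelSpace Y]
    (μ : Measure Y) [IsFiniteMeasure μ] (A : Set Y) (hA : AnalyticSet A) :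
    NullMeasurableSet A μ := by
  by_cases h0 : μ A = 0
  · exact NullMeasurableSet.of_null h0
  obtain ⟨u, -, hu, hlim⟩ := exists_seq_strictMono_tendsto' (pos_iff_ne_zero.2 h0)
  choose K hKA hK hcK using fun n => analytic_inner μ A hA (u n) (hu n).2
  have hm : MeasurableSet (⋃ n, K n) := MeasurableSet.iUnion fun n => (hK n).measurableSet
  have : (⋃ n, K n) =ᵐ[μ] A := by
    refine ae_eq_of_subset_of_measure_ge (iUnion_subset hKA) ?_ hm.nullMeasurableSet
      (measure_ne_top _ _)
    exact le_of_tendsto' hlim fun n => (hcK n).trans (measure_mono (subset_iUnion K n))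
  exact hm.nullMeasurableSet.congr this

lemma aem_of_analytic {Y : Type*} [MetricSpace Y] [MeasurableSpace Y] [BorelSpace Y]
    (μ : Measure Y) [IsFiniteMeasure μ] (F : Y → ℝ) (hA : ∀ c, AnalyticSet {p | c < F p}) :
    AEMeasurable F μ := by
  have : NullMeasurable F μ := by
    have : @Measurable (NullMeasurableSpace Y μ) ℝ _ _ F :=
      measurable_of_Ioi fun c => analytic_null μ _ (hA c)
    exact this
  exact this.aemeasurable

lemma l01_nonneg (y t : ℝ) : 0 ≤ l01 y t := by unfold l01; split_ifs <;> norm_num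
lemma l01_le_one (y t : ℝ) : l01 y t ≤ 1 := by unfold l01; split_ifs <;> norm_num

lemma measurable_sgn : Measurable sgn := by
  unfold sgn
  exact Measurable.ite measurableSet_Ici measurable_const measurable_const

lemma measurable_l01 : Measurable (Function.uncurry l01) := by
  unfold l01 Function.uncurry
  refine Measurable.ite ?_ measurable_const measurable_const
  exact measurableSet_le (measurable_fst.mul (measurable_sgn.comp measurable_snd)) measurable_const

lemma ms_and {α : Type*} [MeasurableSpace α] {p q : α → Prop} (hp : MeasurableSet {a | p a})
    (hq : MeasurableSet {a | q a}) : MeasurableSet {a | p a ∧ q a} := hp.inter hq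

section adv
set_option linter.unusedSectionVars false
variable {X : Type*} [MetricSpace X]

lemma advLoss_nonneg {L : ℝ → ℝ → ℝ} (h0 : ∀ y t, 0 ≤ L y t)
    (ε : ℝ) (x : X) (y : ℝ) (f : X → ℝ) : 0 ≤ advLoss L ε x y f :=
  Real.iSup_nonneg fun _ => h0 _ _

lemma advLoss_le {L : ℝ → ℝ → ℝ} {ε : ℝ} {x : X} {y : ℝ} {f : X → ℝ} {c : ℝ} (hc : 0 ≤ c)
    (h : ∀ x', dist x' x ≤ ε → L y (f x') ≤ c) : advLoss L ε x y f ≤ c :=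
  Real.iSup_le (fun x' => h x'.1 (mem_closedBall.1 x'.2)) hc

lemma advLoss_le_one {L : ℝ → ℝ → ℝ} (h1 : ∀ y t, L y t ≤ 1)
    (ε : ℝ) (x : X) (y : ℝ) (f : X → ℝ) : advLoss L ε x y f ≤ 1 :=
  advLoss_le zero_le_one fun _ _ => h1 _ _

lemma le_advLoss {L : ℝ → ℝ → ℝ} (h1 : ∀ y t, L y t ≤ 1)
    {ε : ℝ} {x : X} (y : ℝ) (f : X → ℝ) {x' : X} (hx : dist x' x ≤ ε) :
    L y (f x') ≤ advLoss L ε x y f := by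
  have : BddAbove (range fun x' : closedBall x ε => L y (f x')) :=
    ⟨1, by rintro _ ⟨z, rfl⟩; exact h1 _ _⟩
  exact le_ciSup this ⟨x', mem_closedBall.2 hx⟩

variable [CompleteSpace X]
    [SecondCountableTopology X] [MeasurableSpace X] [BorelSpace X]

lemma advLoss_aem {L : ℝ → ℝ → ℝ} (hL : Measurable (Function.uncurry L))
    (h1 : ∀ y t, L y t ≤ 1)
    (ε : ℝ) (hε : 0 ≤ ε) (P : Measure (X × ℝ)) [IsFiniteMeasure P] (f : X → ℝ)
    (hf : Measurable f) :
    AEMeasurable (fun p : X × ℝ => advLoss L ε p.1 p.2 f) P := by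
  refine aem_of_analytic P _ fun c => ?_
  have : {p : X × ℝ | c < advLoss L ε p.1 p.2 f} = (fun q : (X × ℝ) × X => q.1) ''
      {q | dist q.2 q.1.1 ≤ ε ∧ c < L q.1.2 (f q.2)} := by
    ext p
    simp only [mem_ofPred_eq, mem_image]
    constructor
    · intro h
      have : Nonempty (closedBall p.1 ε) := ⟨⟨p.1, mem_closedBall_self hε⟩⟩
      obtain ⟨x', hx'⟩ := exists_lt_of_lt_ciSup h
      exact ⟨(p, x'.1), ⟨mem_closedBall.1 x'.2, hx'⟩, rfl⟩
    · rintro ⟨q, ⟨h, h'⟩, rfl⟩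
      exact h'.trans_le (le_advLoss h1 _ f h)
  rw [this]
  refine MeasurableSet.analyticSet_image ?_ measurable_fst
  refine ms_and (measurableSet_le ?_ measurable_const)
    (measurableSet_lt measurable_const ?_)
  · exact measurable_snd.dist (measurable_fst.comp measurable_fst)
  · exact hL.comp ((measurable_snd.comp measurable_fst).prodMk (hf.comp measurable_snd))

lemma int_of_bdd {Ω : Type*} [MeasurableSpace Ω] {μ : Measure Ω} [IsFiniteMeasure μ] {F : Ω → ℝ}
    (hF : AEMeasurable F μ) (h0 : ∀ p, 0 ≤ F p) (h1 : ∀ p, F p ≤ 1) : Integrable F μ :=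
  Integrable.of_bound hF.aestronglyMeasurable 1
    (Eventually.of_forall fun p => by rw [Real.norm_eq_abs, abs_of_nonneg (h0 p)]; exact h1 p)

lemma advLoss_int {L : ℝ → ℝ → ℝ} (hL : Measurable (Function.uncurry L))
    (h0 : ∀ y t, 0 ≤ L y t) (h1 : ∀ y t, L y t ≤ 1)
    (ε : ℝ) (hε : 0 ≤ ε) (P : Measure (X × ℝ)) [IsFiniteMeasure P] (f : X → ℝ)
    (hf : Measurable f) :
    Integrable (fun p : X × ℝ => advLoss L ε p.1 p.2 f) P :=
  int_of_bdd (advLoss_aem hL h1 ε hε P f hf) (fun _ => advLoss_nonneg h0 _ _ _ _)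
    (fun _ => advLoss_le_one h1 _ _ _ _)

lemma stdLoss_meas {L : ℝ → ℝ → ℝ} (hL : Measurable (Function.uncurry L)) (f : X → ℝ)
    (hf : Measurable f) : Measurable (fun p : X × ℝ => L p.2 (f p.1)) :=
  hL.comp (measurable_snd.prodMk (hf.comp measurable_fst))

lemma stdRisk_le_advRisk {L : ℝ → ℝ → ℝ} (hL : Measurable (Function.uncurry L))
    (h0 : ∀ y t, 0 ≤ L y t) (h1 : ∀ y t, L y t ≤ 1)
    (ε : ℝ) (hε : 0 ≤ ε) (P Q : Measure (X × ℝ)) [IsFiniteMeasure P] (hQ : Q ∈ advSet P ε)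
    (f : X → ℝ) (hf : Measurable f) : stdRisk L Q f ≤ advRisk L ε P f := by
  obtain ⟨hQp, γ, hγ, rfl, rfl, hγ1⟩ := hQ
  unfold stdRisk advRisk
  have hi := advLoss_int hL h0 h1 ε hε (γ.map Prod.fst) f hf
  have hm := stdLoss_meas hL f hf
  rw [integral_map measurable_snd.aemeasurable hm.aestronglyMeasurable,
    integral_map measurable_fst.aemeasurable hi.1]
  refine integral_mono_ae (int_of_bdd (hm.comp measurable_snd).aemeasurable
    (fun _ => h0 _ _) (fun _ => h1 _ _)) (hi.comp_measurable measurable_fst) ?_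
  have hms : MeasurableSet {p : (X × ℝ) × (X × ℝ) | dist p.1.1 p.2.1 ≤ ε ∧ p.1.2 = p.2.2} := by
    refine ms_and (measurableSet_le ?_ measurable_const) (measurableSet_eq_fun ?_ ?_)
    · exact (measurable_fst.comp measurable_fst).dist (measurable_fst.comp measurable_snd)
    · exact measurable_snd.comp measurable_fst
    · exact measurable_snd.comp measurable_snd
  have := (mem_ae_iff_prob_eq_one hms).2 hγ1
  filter_upwards [this] with p hp
  rw [← hp.2]
  exact le_advLoss h1 _ f (by rw [dist_comm]; exact hp.1)

lemma advSet_labels {ε : ℝ} {P Q : Measure (X × ℝ)} [IsProbabilityMeasure P]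
    (hlabels : P {p : X × ℝ | p.2 = 1 ∨ p.2 = -1} = 1) (hQ : Q ∈ advSet P ε) :
    ∀ᵐ p ∂Q, p.2 = 1 ∨ p.2 = -1 := by
  have hml : MeasurableSet {p : X × ℝ | p.2 = 1 ∨ p.2 = -1} := 
    (measurableSet_eq_fun measurable_snd measurable_const).union
      (measurableSet_eq_fun measurable_snd measurable_const)
  have hP : ∀ᵐ p ∂P, p.2 = 1 ∨ p.2 = -1 := (mem_ae_iff_prob_eq_one hml).2 hlabels
  obtain ⟨hQp, γ, hγ, rfl, rfl, hγ1⟩ := hQ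
  have hms : MeasurableSet {p : (X × ℝ) × (X × ℝ) | dist p.1.1 p.2.1 ≤ ε ∧ p.1.2 = p.2.2} := by
    refine ms_and (measurableSet_le ?_ measurable_const) (measurableSet_eq_fun ?_ ?_)
    · exact (measurable_fst.comp measurable_fst).dist (measurable_fst.comp measurable_snd)
    · exact measurable_snd.comp measurable_fst
    · exact measurable_snd.comp measurable_snd
  have h2 := (mem_ae_iff_prob_eq_one hms).2 hγ1
  rw [ae_map_iff measurable_fst.aemeasurable hml] at hP
  rw [ae_map_iff measurable_snd.aemeasurable hml]
  filter_upwards [hP, h2] with p hp1 hp2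
  rw [← hp2.2]; exact hp1

end adv

lemma l01_one (s : ℝ) : l01 1 s = if s < 0 then 1 else 0 := by
  unfold l01 sgn
  by_cases h : 0 ≤ s
  · simp [h, not_lt.2 h]
  · simp [h, not_le.1 h]

lemma l01_neg (s : ℝ) : l01 (-1) s = if 0 ≤ s then 1 else 0 := by
  unfold l01 sgn
  by_cases h : 0 ≤ s
  · simp [h]
  · simp [h]

lemma int_lt {h : ℝ} (h0 : 0 ≤ h) : ∫ t in Ioo (0:ℝ) 1, (if t < h then (1:ℝ) else 0) ≤ h := by
  have : (fun t : ℝ => if t < h then (1:ℝ) else 0) = (Iio h).indicator 1 := by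
    ext t; simp [indicator, mem_Iio]
  rw [this, integral_indicator_one measurableSet_Iio]
  rw [measureReal_restrict_apply measurableSet_Iio]
  calc _ ≤ volume.real (Ioo 0 h) := measureReal_mono (fun t ht => ⟨ht.2.1, ht.1⟩) (by simp)
    _ = h := by simp [h0]

lemma int_ge {h : ℝ} (h0 : h ≤ 1) :
    ∫ t in Ioo (0:ℝ) 1, (if h ≤ t then (1:ℝ) else 0) ≤ 1 - h := by
  have : (fun t : ℝ => if h ≤ t then (1:ℝ) else 0) = (Ici h).indicator 1 := by
    ext t; simp [indicator, mem_Ici]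
  rw [this, integral_indicator_one measurableSet_Ici]
  rw [measureReal_restrict_apply measurableSet_Ici]
  calc _ ≤ volume.real (Ico h 1) := measureReal_mono (fun t ht => ⟨ht.1, ht.2.2⟩) (by simp)
    _ = 1 - h := by simp [h0]

lemma fubini_lower {Ω : Type*} [MeasurableSpace Ω] (μ : Measure Ω) [IsProbabilityMeasure μ]
    (k : ℝ → Ω → ℝ) (hk : Measurable (Function.uncurry k)) (h0 : ∀ t p, 0 ≤ k t p)
    (h1 : ∀ t p, k t p ≤ 1) (w : Ω → ℝ) (hw : Integrable w μ)
    (hkw : ∀ᵐ p ∂μ, ∫ t in Ioo (0:ℝ) 1, k t p ≤ w p) (r : ℝ)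
    (hr : ∀ t ∈ Ioo (0:ℝ) 1, r ≤ ∫ p, k t p ∂μ) : r ≤ ∫ p, w p ∂μ := by
  have hI : Integrable (Function.uncurry k) ((volume.restrict (Ioo (0:ℝ) 1)).prod μ) :=
    int_of_bdd hk.aemeasurable (fun _ => h0 _ _) (fun _ => h1 _ _)
  calc r = ∫ t in Ioo (0:ℝ) 1, r := by simp
    _ ≤ ∫ t in Ioo (0:ℝ) 1, ∫ p, k t p ∂μ :=
        setIntegral_mono_on (by simp) hI.integral_prod_left measurableSet_Ioo hr
    _ = ∫ p, (∫ t in Ioo (0:ℝ) 1, k t p) ∂μ := integral_integral_swap hI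
    _ ≤ ∫ p, w p ∂μ := integral_mono_ae hI.integral_prod_right hw hkw

lemma surrogate {X : Type*} [MeasurableSpace X]
    (Q : Measure (X × ℝ)) [IsProbabilityMeasure Q] (hl : ∀ᵐ p ∂Q, p.2 = 1 ∨ p.2 = -1)
    (τ : ℝ) (hτ : 0 ≤ τ) (ψ : ℝ → ℝ) (hcont : Continuous ψ) (hdec : Antitone ψ)
    (hodd : ∀ α, ψ (-α) = -ψ α) (hlb : ∀ α, -(1/2) ≤ ψ α) (hub : ∀ α, ψ α ≤ 1/2)
    (φ : ℝ → ℝ) (hφ : ∀ α, φ α = 1/2 + ψ (α - τ)) (q : ℝ)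
    (hq : ∀ g : X → ℝ, Measurable g → q ≤ stdRisk l01 Q g) (f : X → ℝ) (hf : Measurable f) :
    stdRisk l01 Q f + q ≤ 2 * stdRisk (margin φ) Q f := by
  have hψ0 : ψ 0 = 0 := by have := hodd 0; simp at this; linarith
  have hφc : Continuous φ := by
    rw [show φ = fun α => 1/2 + ψ (α - τ) from funext hφ]; fun_prop
  set h : X → ℝ := fun x => if f x < 0 then 2 * ψ (f x - τ) else 1 + 2 * ψ (f x + τ) with hh
  have hhm : Measurable h := by
    refine Measurable.ite (measurableSet_lt hf measurable_const) ?_ ?_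
    · exact ((hcont.measurable).comp (hf.sub_const τ)).const_mul 2
    · exact (((hcont.measurable).comp (hf.add_const τ)).const_mul 2).const_add 1
  have hh0 : ∀ x, 0 ≤ h x := by
    intro x
    simp only [hh]
    split_ifs with hx
    · have := hdec (show f x - τ ≤ 0 by linarith); linarith
    · have := hlb (f x + τ); linarith
  have hh1 : ∀ x, h x ≤ 1 := by
    intro x
    simp only [hh]
    split_ifs with hx
    · have := hub (f x - τ); linarith
    · have := hdec (show 0 ≤ f x + τ by linarith); linarith
  set w : X × ℝ → ℝ := fun p => if p.2 = 1 then h p.1 else 1 - h p.1 with hw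
  have hwm : Measurable w := by
    refine Measurable.ite (measurableSet_eq_fun measurable_snd measurable_const) ?_ ?_
    · exact hhm.comp measurable_fst
    · exact (hhm.comp measurable_fst).const_sub 1
  have hwi : Integrable w Q := by
    refine int_of_bdd hwm.aemeasurable (fun p => ?_) (fun p => ?_) <;> simp only [hw] <;>
      split_ifs <;> linarith [hh0 p.1, hh1 p.1]
  have key : q ≤ ∫ p, w p ∂Q := by
    refine fubini_lower Q (fun t p => l01 p.2 (t - h p.1)) ?_ (fun _ _ => l01_nonneg _ _)
      (fun _ _ => l01_le_one _ _) w hwi ?_ q ?_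
    · exact measurable_l01.comp ((measurable_snd.comp measurable_snd).prodMk
        (measurable_fst.sub (hhm.comp (measurable_fst.comp measurable_snd))))
    · filter_upwards [hl] with p hp
      rcases hp with hp | hp
      · simp only [hp, hw, l01_one, sub_neg, if_true]
        exact int_lt (hh0 _)
      · simp only [hp, hw, l01_neg, sub_nonneg]
        rw [if_neg (by norm_num)]
        exact int_ge (hh1 _)
    · intro t _
      exact hq (fun x => t - h x) (hhm.const_sub t)
  have hi1 : Integrable (fun p : X × ℝ => l01 p.2 (f p.1)) Q :=
    int_of_bdd (measurable_l01.comp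
      (measurable_snd.prodMk (hf.comp measurable_fst))).aemeasurable
      (fun _ => l01_nonneg _ _) (fun _ => l01_le_one _ _)
  have hi2 : Integrable (fun p : X × ℝ => margin φ p.2 (f p.1)) Q := by
    refine int_of_bdd ?_ (fun p => ?_) (fun p => ?_)
    · exact (hφc.measurable.comp (measurable_snd.mul (hf.comp measurable_fst))).aemeasurable
    · simp only [margin, hφ]; linarith [hlb (p.2 * f p.1 - τ)]
    · simp only [margin, hφ]; linarith [hub (p.2 * f p.1 - τ)]
  unfold stdRisk
  calc _ ≤ ∫ p, l01 p.2 (f p.1) ∂Q + ∫ p, w p ∂Q := by linarith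
    _ = ∫ p, (l01 p.2 (f p.1) + w p) ∂Q := (integral_add hi1 hwi).symm
    _ ≤ ∫ p, 2 * margin φ p.2 (f p.1) ∂Q := by
        refine integral_mono_ae (hi1.add hwi) (hi2.const_mul 2) ?_
        filter_upwards [hl] with p hp
        have hmono := hdec (show f p.1 - τ ≤ f p.1 + τ by linarith)
        have hod := hodd (f p.1 + τ)
        rcases hp with hp | hp
        · simp only [hp, hw, l01_one, margin, hφ, hh, if_true, one_mul]
          split_ifs <;> linarith
        · have e : -1 * f p.1 - τ = -(f p.1 + τ) := by ring
          simp only [hp, hw, l01_neg, margin, hφ, hh, e, hod]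
          rw [if_neg (by norm_num : ¬ ((-1:ℝ) = 1))]
          split_ifs <;> linarith
    _ = _ := integral_const_mul _ _

section dual
variable {X : Type*} [MetricSpace X] [ProperSpace X] [CompleteSpace X]
    [SecondCountableTopology X] [MeasurableSpace X] [BorelSpace X]

lemma dual_lower (ε : ℝ) (hε : 0 ≤ ε) (P : Measure (X × ℝ)) [IsProbabilityMeasure P]
    (hl : ∀ᵐ p ∂P, p.2 = 1 ∨ p.2 = -1) (r : ℝ)
    (hr : ∀ g : X → ℝ, Measurable g → r ≤ advRisk l01 ε P g)
    (W : X × ℝ → ℝ) (hWc : Continuous W) (hW0 : ∀ p, 0 ≤ W p) (hWi : Integrable W P)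
    (hW : ∀ x z y, dist x z ≤ ε → dist z y ≤ ε → 1 ≤ W (x, 1) + W (y, -1)) :
    r ≤ ∫ p, W p ∂P := by
  set k : ℝ → X × ℝ → ℝ := fun t p =>
    if p.2 = 1 then (if t < W p then 1 else 0) else (if 1 - W p ≤ t then 1 else 0) with hk
  have hk0 : ∀ t p, 0 ≤ k t p := by
    intro t p; simp only [hk]; split_ifs <;> norm_num
  have hk1 : ∀ t p, k t p ≤ 1 := by
    intro t p; simp only [hk]; split_ifs <;> norm_num
  have hkm : Measurable (Function.uncurry k) := by
    have hWm : Measurable fun q : ℝ × (X × ℝ) => W q.2 := hWc.measurable.comp measurable_snd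
    refine Measurable.ite (measurableSet_eq_fun (measurable_snd.comp measurable_snd)
      measurable_const) ?_ ?_
    · exact Measurable.ite (measurableSet_lt measurable_fst hWm) measurable_const measurable_const
    · exact Measurable.ite (measurableSet_le (hWm.const_sub 1) measurable_fst)
        measurable_const measurable_const
  refine fubini_lower P k hkm hk0 hk1 W hWi ?_ r ?_
  · refine Eventually.of_forall fun p => ?_
    by_cases hp : p.2 = 1
    · simp only [hk, hp, if_true]
      exact int_lt (hW0 p)
    · simp only [hk, hp, if_false]
      exact (int_ge (by linarith [hW0 p])).trans (by linarith)
  · intro t _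
    have hcl : IsClosed {x : X | W (x, 1) ≤ t} :=
      isClosed_le (hWc.comp (by fun_prop)) continuous_const
    have hA : ∀ z, z ∈ cthickening ε {x : X | W (x, 1) ≤ t} ↔
        ∃ x, W (x, 1) ≤ t ∧ dist z x ≤ ε := by
      intro z
      rw [hcl.cthickening_eq_biUnion_closedBall hε]
      simp
    classical
    set g : X → ℝ := fun z => if z ∈ cthickening ε {x : X | W (x, 1) ≤ t} then 1 else -1 with hg
    have hgm : Measurable g :=
      Measurable.ite isClosed_cthickening.measurableSet measurable_const measurable_const
    refine (hr g hgm).trans ?_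
    refine integral_mono_ae (advLoss_int measurable_l01 l01_nonneg l01_le_one ε hε P g hgm)
      (int_of_bdd (hkm.comp measurable_prodMk_left).aemeasurable
        (fun _ => hk0 _ _) (fun _ => hk1 _ _)) ?_
    filter_upwards [hl] with p hp
    refine advLoss_le (hk0 t p) fun x' hx' => ?_
    obtain ⟨x, y⟩ := p
    simp only at hp hx'
    rcases hp with rfl | rfl
    · simp only [hk, if_true, l01_one]
      by_cases hc : t < W (x, 1)
      · simp only [hc, if_true]; split_ifs <;> norm_num
      · have : x' ∈ cthickening ε {x : X | W (x, 1) ≤ t} := (hA x').2 ⟨x, not_lt.1 hc, hx'⟩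
        simp only [hg, this, if_true]
        norm_num [hc]
    · simp only [hk, l01_neg]
      rw [if_neg (by norm_num : ¬ ((-1:ℝ) = 1))]
      by_cases hc : 1 - W (x, -1) ≤ t
      · simp only [hc, if_true]; split_ifs <;> norm_num
      · have : x' ∉ cthickening ε {x : X | W (x, 1) ≤ t} := by
          rw [hA]
          rintro ⟨u, hu, hd⟩
          have := hW u x' x (by rw [dist_comm]; exact hd) hx'
          linarith
        simp only [hg, this, if_false]
        norm_num [hc]

end dual

section hb
open BoundedContinuousFunction CompactlySupported

variable {T Y : Type*} [MetricSpace T] [MetricSpace Y] [MeasurableSpace Y]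
  [BorelSpace Y]

lemma hb_exists [Nonempty T] (P : Measure Y) [IsProbabilityMeasure P] (i j : T → Y)
    (r : ℝ) (hr : ∀ W : Y →ᵇ ℝ, (∀ p, 0 ≤ W p) → (∀ t, 1 ≤ W (i t) + W (j t)) →
      r ≤ ∫ p, W p ∂P) :
    ∃ L : (T →ᵇ ℝ) →ₗ[ℝ] ℝ, r ≤ L 1 ∧ ∀ (h : T →ᵇ ℝ) (W : Y →ᵇ ℝ), (∀ p, 0 ≤ W p) →
      (∀ t, h t ≤ W (i t) + W (j t)) → L h ≤ ∫ p, W p ∂P := by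
  set S : (T →ᵇ ℝ) → Set ℝ := fun h => {v | ∃ W : Y →ᵇ ℝ, (∀ p, 0 ≤ W p) ∧
    (∀ t, h t ≤ W (i t) + W (j t)) ∧ v = ∫ p, W p ∂P} with hS
  set N : (T →ᵇ ℝ) → ℝ := fun h => sInf (S h) with hN
  have hbdd : ∀ h, BddBelow (S h) := by
    intro h
    refine ⟨0, ?_⟩
    rintro _ ⟨W, hW, -, rfl⟩
    exact integral_nonneg hW
  have hne : ∀ h, (S h).Nonempty := by
    intro h
    refine ⟨_, BoundedContinuousFunction.const Y ‖h‖, fun p => norm_nonneg h, fun t => ?_, rfl⟩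
    have h1 := (le_abs_self _).trans (h.norm_coe_le_norm t)
    have h2 := norm_nonneg h
    simp only [BoundedContinuousFunction.const_apply]
    linarith
  have hNle : ∀ (h : T →ᵇ ℝ) (W : Y →ᵇ ℝ), (∀ p, 0 ≤ W p) →
      (∀ t, h t ≤ W (i t) + W (j t)) → N h ≤ ∫ p, W p ∂P :=
    fun h W h1 h2 => csInf_le (hbdd h) ⟨W, h1, h2, rfl⟩
  have hN0 : ∀ h, 0 ≤ N h := by
    intro h
    refine le_csInf (hne h) ?_
    rintro _ ⟨W, hW, -, rfl⟩
    exact integral_nonneg hW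
  have hom1 : ∀ c : ℝ, 0 < c → ∀ x, N (c • x) ≤ c * N x := by
    intro c hc x
    rw [← div_le_iff₀' hc]
    refine le_csInf (hne x) ?_
    rintro _ ⟨W, hW, hW2, rfl⟩
    rw [div_le_iff₀' hc, ← integral_const_mul]
    refine hNle (c • x) (c • W) (fun p => ?_) (fun t => ?_)
    · simpa using mul_nonneg hc.le (hW p)
    · have := mul_le_mul_of_nonneg_left (hW2 t) hc.le
      simp only [BoundedContinuousFunction.coe_smul, smul_eq_mul]
      linarith
  have hom : ∀ c : ℝ, 0 < c → ∀ x, N (c • x) = c * N x := by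
    intro c hc x
    refine le_antisymm (hom1 c hc x) ?_
    have := hom1 c⁻¹ (inv_pos.2 hc) (c • x)
    rw [smul_smul, inv_mul_cancel₀ hc.ne', one_smul] at this
    rwa [inv_mul_eq_div, le_div_iff₀' hc] at this
  have hadd : ∀ x y, N (x + y) ≤ N x + N y := by
    intro x y
    rw [← sub_le_iff_le_add]
    refine le_csInf (hne x) ?_
    rintro _ ⟨W, hW, hW2, rfl⟩
    rw [sub_le_comm]
    refine le_csInf (hne y) ?_
    rintro _ ⟨V, hV, hV2, rfl⟩
    rw [sub_le_iff_le_add', ← integral_add (W.integrable P) (V.integrable P)]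
    refine hNle (x + y) (W + V) (fun p => add_nonneg (hW p) (hV p)) (fun t => ?_)
    have h1 := hW2 t
    have h2 := hV2 t
    simp only [BoundedContinuousFunction.coe_add, Pi.add_apply]
    linarith
  have hone : (1 : T →ᵇ ℝ) ≠ 0 := by
    intro h
    obtain ⟨t⟩ := ‹Nonempty T›
    have := DFunLike.congr_fun h t
    simp at this
  obtain ⟨L, hL1, hL2⟩ := exists_extension_of_le_sublinear
    (LinearPMap.mkSpanSingleton (1 : T →ᵇ ℝ) (N 1) hone) N hom hadd (by
      rintro ⟨x, hx⟩
      obtain ⟨c, rfl⟩ := Submodule.mem_span_singleton.1 hx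
      have e : (LinearPMap.mkSpanSingleton (1 : T →ᵇ ℝ) (N 1) hone : _ →ₗ.[ℝ] ℝ)
        ⟨c • 1, hx⟩ = c • N 1 := LinearPMap.mkSpanSingleton'_apply _ _ _ _ _
      rw [e, smul_eq_mul]
      rcases lt_or_ge 0 c with hc | hc
      · exact (hom c hc 1).ge
      · exact (mul_nonpos_of_nonpos_of_nonneg hc (hN0 1)).trans (hN0 _))
  refine ⟨L, ?_, fun h W h1 h2 => (hL2 h).trans (hNle h W h1 h2)⟩
  have h3 := hL1 ⟨1, Submodule.mem_span_singleton_self _⟩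
  rw [LinearPMap.mkSpanSingleton_apply] at h3
  rw [h3]
  refine le_csInf (hne 1) ?_
  rintro _ ⟨W, hW, hW2, rfl⟩
  exact hr W hW hW2

lemma matching [Nonempty T] [LocallyCompactSpace T] [MeasurableSpace T] [BorelSpace T]
    [LocallyCompactSpace Y] [SecondCountableTopology Y]
    (P : Measure Y) [IsProbabilityMeasure P] (i j : T → Y)
    (hi : Continuous i) (hj : Continuous j)
    (hi2 : ∀ K, IsCompact K → IsCompact (i ⁻¹' K)) (hj2 : ∀ K, IsCompact K → IsCompact (j ⁻¹' K))
    (r : ℝ) (hr : ∀ W : Y →ᵇ ℝ, (∀ p, 0 ≤ W p) → (∀ t, 1 ≤ W (i t) + W (j t)) →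
      r ≤ ∫ p, W p ∂P) :
    ∃ π : Measure T, IsFiniteMeasure π ∧ π.map i + π.map j ≤ P ∧ r ≤ π.real univ := by
  obtain ⟨L, hL1, hL⟩ := hb_exists P i j r hr
  let emb : C_c(T, ℝ) →ₗ[ℝ] (T →ᵇ ℝ) :=
    { toFun := fun f => (f : T →ᵇ ℝ)
      map_add' := fun f g => by ext; rfl
      map_smul' := fun c f => by ext; rfl }
  let Λ : C_c(T, ℝ) →ₚ[ℝ] ℝ := PositiveLinearMap.mk₀ (L.comp emb) (by
    intro f hf
    have := hL (-(emb f)) 0 (fun p => le_rfl) (fun t => by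
      have : 0 ≤ f t := hf t
      simpa [emb] using this)
    simp only [map_neg, BoundedContinuousFunction.coe_zero, Pi.zero_apply,
      integral_zero] at this
    simpa using this)
  have hΛ : ∀ f, Λ f = L (emb f) := fun f => rfl
  let π := RealRMK.rieszMeasure Λ
  -- pullbacks
  have pull : ∀ (i : T → Y) (hi : Continuous i) (hi2 : ∀ K, IsCompact K → IsCompact (i ⁻¹' K))
      (χ : C(Y, ℝ)) (hχ : HasCompactSupport χ), ∃ f : C_c(T, ℝ), ∀ t, f t = χ (i t) := by
    intro i hi hi2 χ hχ
    refine ⟨⟨⟨fun t => χ (i t), χ.continuous.comp hi⟩, ?_⟩, fun t => rfl⟩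
    refine HasCompactSupport.intro (hi2 _ hχ) fun t ht => ?_
    exact image_eq_zero_of_notMem_tsupport (f := χ) ht
  have hK : ∀ K U, IsCompact K → IsOpen U → K ⊆ U → π (i ⁻¹' K) + π (j ⁻¹' K) ≤ P U := by
    intro K U hKc hU hKU
    obtain ⟨χ, h1, h2, h3, h4⟩ := exists_continuous_one_zero_of_isCompact hKc hU.isClosed_compl
      (disjoint_compl_right_iff_subset.2 hKU)
    obtain ⟨f, hf⟩ := pull i hi hi2 χ h3
    obtain ⟨g, hg⟩ := pull j hj hj2 χ h3
    have hf0 : ∀ t, 0 ≤ f t := fun t => by rw [hf]; exact (h4 _).1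
    have hg0 : ∀ t, 0 ≤ g t := fun t => by rw [hg]; exact (h4 _).1
    have e1 : π (i ⁻¹' K) ≤ ENNReal.ofReal (Λ f) :=
      RealRMK.rieszMeasure_le_of_eq_one Λ hf0 (hi2 K hKc) fun t ht => by rw [hf]; exact h1 ht
    have e2 : π (j ⁻¹' K) ≤ ENNReal.ofReal (Λ g) :=
      RealRMK.rieszMeasure_le_of_eq_one Λ hg0 (hj2 K hKc) fun t ht => by rw [hg]; exact h1 ht
    let W : Y →ᵇ ℝ := ((⟨χ, h3⟩ : C_c(Y, ℝ)) : Y →ᵇ ℝ)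
    have hW : ∀ p, W p = χ p := fun p => rfl
    calc _ ≤ ENNReal.ofReal (Λ f) + ENNReal.ofReal (Λ g) := add_le_add e1 e2
      _ = ENNReal.ofReal (Λ f + Λ g) :=
        (ENNReal.ofReal_add (Λ.map_nonneg hf0) (Λ.map_nonneg hg0)).symm
      _ ≤ ENNReal.ofReal (∫ p, W p ∂P) := by
        apply ENNReal.ofReal_le_ofReal
        rw [← map_add, hΛ]
        refine hL _ W (fun p => (h4 p).1) fun t => ?_
        rw [hW, hW, ← hf, ← hg]
        exact le_rfl
      _ ≤ P U := integral_le_measure (fun x _ => (h4 x).2) (fun x hx => (h2 hx).le)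
  have hmap : ∀ s, MeasurableSet s → (π.map i + π.map j) s = π (i ⁻¹' s) + π (j ⁻¹' s) := by
    intro s hs
    rw [Measure.add_apply, Measure.map_apply hi.measurable hs, Measure.map_apply hj.measurable hs]
  have : IsFiniteMeasureOnCompacts (π.map i + π.map j) := by
    constructor
    intro K hKc
    rw [hmap K hKc.measurableSet]
    exact (hK K univ hKc isOpen_univ (subset_univ _)).trans_lt (measure_lt_top _ _)
  have hle : π.map i + π.map j ≤ P := by
    refine Measure.le_intro fun s hs _ => ?_
    rw [s.measure_eq_iInf_isOpen P]
    refine le_iInf₂ fun U hU => le_iInf fun hUo => ?_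
    refine (measure_mono hU).trans ?_
    rw [hUo.measure_eq_iSup_isCompact]
    refine iSup₂_le fun K hKU => iSup_le fun hKc => ?_
    rw [hmap K hKc.measurableSet]
    exact hK K U hKc hUo hKU
  have hfin : IsFiniteMeasure π := by
    constructor
    have := hle univ
    rw [hmap _ MeasurableSet.univ] at this
    simp only [preimage_univ, measure_univ] at this
    exact (le_self_add.trans this).trans_lt ENNReal.one_lt_top
  refine ⟨π, hfin, hle, ?_⟩
  refine le_of_forall_pos_le_add fun δ hδ => ?_
  obtain ⟨K, -, hKc, hKδ⟩ := MeasurableSet.univ.exists_isCompact_sdiff_lt (μ := P)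
    (measure_ne_top _ _) (ENNReal.ofReal_pos.2 hδ).ne'
  obtain ⟨χ, h1, -, h3, h4⟩ := exists_continuous_one_zero_of_isCompact hKc isClosed_empty
      (disjoint_empty _)
  obtain ⟨f, hf⟩ := pull i hi hi2 χ h3
  let V : Y →ᵇ ℝ := ((⟨χ, h3⟩ : C_c(Y, ℝ)) : Y →ᵇ ℝ)
  have hV : ∀ p, (1 - V) p = 1 - χ p := fun p => rfl
  have hb := hL (1 - emb f) (1 - V) (fun p => by rw [hV]; linarith [(h4 p).2]) (fun t => by
    have : (1 - emb f) t = 1 - f t := rfl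
    rw [this, hV, hV, hf]
    linarith [(h4 (j t)).2])
  have hint : ∫ p, (1 - V) p ∂P ≤ δ := by
    have : ENNReal.ofReal (∫ p, (1 - V) p ∂P) ≤ P (univ \ K) := by
      refine integral_le_measure (fun x _ => ?_) (fun x hx => ?_)
      · rw [hV]; linarith [(h4 x).1]
      · have hx' : x ∈ K := by simpa using hx
        have := h1 hx'
        rw [hV, this]; simp
    exact (ENNReal.ofReal_le_ofReal_iff hδ.le).1 (this.trans hKδ.le)
  rw [map_sub] at hb
  have hm : Λ f ≤ π.real univ := by
    have := RealRMK.le_rieszMeasure_tsupport_subset Λ (f := f)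
      (fun t => by rw [hf]; exact h4 _) (subset_univ _)
    exact (ENNReal.ofReal_le_iff_le_toReal (measure_ne_top _ _)).1 this
  have := hΛ f
  linarith

end hb

section final
open BoundedContinuousFunction

variable {X : Type*} [MetricSpace X] [ProperSpace X] [CompleteSpace X]
    [SecondCountableTopology X] [MeasurableSpace X] [BorelSpace X]

lemma duality (ε : ℝ) (hε : 0 ≤ ε) (P : Measure (X × ℝ)) [IsProbabilityMeasure P]
    (hl : ∀ᵐ p ∂P, p.2 = 1 ∨ p.2 = -1) (r : ℝ)
    (hr : ∀ g : X → ℝ, Measurable g → r ≤ advRisk l01 ε P g) :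
    ∃ Q ∈ advSet P ε, ∀ g : X → ℝ, Measurable g → r ≤ stdRisk l01 Q g := by
  obtain ⟨⟨x0, _⟩⟩ : Nonempty (X × ℝ) := P.nonempty_of_neZero
  let C : Set (X × X × X) := {q | dist q.1 q.2.1 ≤ ε ∧ dist q.2.1 q.2.2 ≤ ε}
  have hC : IsClosed C :=
    (isClosed_le (f := fun q : X × X × X => dist q.1 q.2.1) (by fun_prop) continuous_const).inter
      (isClosed_le (f := fun q : X × X × X => dist q.2.1 q.2.2) (by fun_prop) continuous_const)
  have hCe : Topology.IsClosedEmbedding (Subtype.val : C → X × X × X) := hC.isClosedEmbedding_subtypeVal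
  have : LocallyCompactSpace C := hCe.locallyCompactSpace
  have : Nonempty C := ⟨⟨(x0, x0, x0), by simp [C, hε]⟩⟩
  let i : C → X × ℝ := fun t => (t.1.1, 1)
  let j : C → X × ℝ := fun t => (t.1.2.2, -1)
  have hi : Continuous i := by fun_prop
  have hj : Continuous j := by fun_prop
  have hbig : ∀ R : ℝ, IsCompact ((Subtype.val : C → X × X × X) ⁻¹'
      (closedBall x0 R ×ˢ closedBall x0 R ×ˢ closedBall x0 R)) := fun R =>
    hCe.isCompact_preimage ((isCompact_closedBall _ _).prod
      ((isCompact_closedBall _ _).prod (isCompact_closedBall _ _)))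
  have hKb : ∀ K : Set (X × ℝ), IsCompact K → ∃ R, ∀ p ∈ K, dist p.1 x0 ≤ R := by
    intro K hK
    obtain ⟨R, hR⟩ := (hK.image continuous_fst).isBounded.subset_closedBall x0
    exact ⟨R, fun p hp => hR (mem_image_of_mem _ hp)⟩
  have hi2 : ∀ K, IsCompact K → IsCompact (i ⁻¹' K) := by
    intro K hK
    obtain ⟨R, hR⟩ := hKb K hK
    refine (hbig (R + 2 * ε)).of_isClosed_subset (hK.isClosed.preimage hi) ?_
    rintro ⟨⟨x, z, y⟩, h1, h2⟩ hq
    have h3 : dist x x0 ≤ R := hR _ hq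
    simp only at h1 h2
    have h4 := dist_triangle z x x0
    have h5 := dist_triangle y z x0
    rw [dist_comm] at h1 h2
    simp only [mem_preimage, mem_prod, mem_closedBall]
    refine ⟨?_, ?_, ?_⟩ <;> linarith
  have hj2 : ∀ K, IsCompact K → IsCompact (j ⁻¹' K) := by
    intro K hK
    obtain ⟨R, hR⟩ := hKb K hK
    refine (hbig (R + 2 * ε)).of_isClosed_subset (hK.isClosed.preimage hj) ?_
    rintro ⟨⟨x, z, y⟩, h1, h2⟩ hq
    have h3 : dist y x0 ≤ R := hR _ hq
    simp only at h1 h2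
    have h4 := dist_triangle z y x0
    have h5 := dist_triangle x z x0
    simp only [mem_preimage, mem_prod, mem_closedBall]
    refine ⟨?_, ?_, ?_⟩ <;> linarith
  obtain ⟨π, hπ, hle, hmass⟩ := matching P i j hi hj hi2 hj2 r (by
    intro W hW0 hW
    exact dual_lower ε hε P hl r hr W W.continuous hW0 (W.integrable P)
      fun x z y h1 h2 => hW ⟨(x, z, y), h1, h2⟩)
  let a : C → (X × ℝ) × (X × ℝ) := fun t => ((t.1.1, 1), (t.1.2.1, 1))
  let b : C → (X × ℝ) × (X × ℝ) := fun t => ((t.1.2.2, -1), (t.1.2.1, -1))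
  let d : X × ℝ → (X × ℝ) × (X × ℝ) := fun p => (p, p)
  have ha : Measurable a := (show Continuous a by fun_prop).measurable
  have hb : Measurable b := (show Continuous b by fun_prop).measurable
  have hd : Measurable d := (show Continuous d by fun_prop).measurable
  let ρ := P - (π.map i + π.map j)
  have hρ : ρ + (π.map i + π.map j) = P := Measure.sub_add_cancel_of_le hle
  let γ := ρ.map d + (π.map a + π.map b)
  have hfst : γ.map Prod.fst = P := by
    simp only [γ]
    rw [Measure.map_add _ _ measurable_fst, Measure.map_add _ _ measurable_fst,
      Measure.map_map measurable_fst hd, Measure.map_map measurable_fst ha,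
      Measure.map_map measurable_fst hb]
    have : Prod.fst ∘ d = id := rfl
    rw [this, Measure.map_id]
    exact hρ
  have hγ : IsProbabilityMeasure γ := by
    constructor
    have := Measure.map_apply (μ := γ) measurable_fst MeasurableSet.univ
    rw [hfst] at this
    simpa using this.symm
  have hms : MeasurableSet {p : (X × ℝ) × (X × ℝ) | dist p.1.1 p.2.1 ≤ ε ∧ p.1.2 = p.2.2} := by
    refine ms_and (measurableSet_le ?_ measurable_const) (measurableSet_eq_fun ?_ ?_)
    · exact (measurable_fst.comp measurable_fst).dist (measurable_fst.comp measurable_snd)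
    · exact measurable_snd.comp measurable_fst
    · exact measurable_snd.comp measurable_snd
  have hρf : IsFiniteMeasure ρ := inferInstance
  refine ⟨γ.map Prod.snd, ⟨Measure.isProbabilityMeasure_map measurable_snd.aemeasurable,
    γ, hγ, hfst, rfl, ?_⟩, ?_⟩
  · rw [← mem_ae_iff_prob_eq_one hms]
    change ∀ᵐ p ∂γ, _
    simp only [γ, ae_add_measure_iff]
    refine ⟨?_, ?_, ?_⟩
    · rw [ae_map_iff hd.aemeasurable hms]
      exact Eventually.of_forall fun p => by simp [d, hε]
    · rw [ae_map_iff ha.aemeasurable hms]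
      exact Eventually.of_forall fun p => ⟨p.2.1, rfl⟩
    · rw [ae_map_iff hb.aemeasurable hms]
      exact Eventually.of_forall fun p => ⟨by rw [dist_comm]; exact p.2.2, rfl⟩
  · intro g hg
    unfold stdRisk
    have hm := stdLoss_meas measurable_l01 g hg
    have hm2 : Measurable fun p : (X × ℝ) × (X × ℝ) => l01 p.2.2 (g p.2.1) :=
      hm.comp measurable_snd
    have hint : ∀ μ : Measure ((X × ℝ) × (X × ℝ)), IsFiniteMeasure μ →
        Integrable (fun p : (X × ℝ) × (X × ℝ) => l01 p.2.2 (g p.2.1)) μ := fun μ _ =>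
      int_of_bdd hm2.aemeasurable (fun _ => l01_nonneg _ _) (fun _ => l01_le_one _ _)
    rw [integral_map measurable_snd.aemeasurable hm.aestronglyMeasurable]
    simp only [γ]
    rw [integral_add_measure (hint _ inferInstance) (hint _ inferInstance),
      integral_add_measure (hint _ inferInstance) (hint _ inferInstance),
      integral_map ha.aemeasurable hm2.aestronglyMeasurable,
      integral_map hb.aemeasurable hm2.aestronglyMeasurable]
    have h1 : 0 ≤ ∫ p, l01 p.2.2 (g p.2.1) ∂(ρ.map d) := integral_nonneg fun _ => l01_nonneg _ _
    have h2 : ∫ t, l01 (a t).2.2 (g (a t).2.1) ∂π + ∫ t, l01 (b t).2.2 (g (b t).2.1) ∂π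
        = π.real univ := by
      have i1 : Integrable (fun t => l01 (a t).2.2 (g (a t).2.1)) π :=
        (hint _ inferInstance).comp_measurable ha
      have i2 : Integrable (fun t => l01 (b t).2.2 (g (b t).2.1)) π :=
        (hint _ inferInstance).comp_measurable hb
      rw [← integral_add i1 i2]
      have : ∀ t, l01 (a t).2.2 (g (a t).2.1) + l01 (b t).2.2 (g (b t).2.1) = 1 := by
        intro t
        simp only [a, b, l01_one, l01_neg]
        by_cases h : g t.1.2.1 < 0
        · simp [h, not_le.2 h]
        · simp [h, not_lt.1 h]
      simp only [this]
      simp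
    linarith

lemma adv_surrogate_le (ε : ℝ) (hε : 0 ≤ ε) (P : Measure (X × ℝ)) [IsProbabilityMeasure P]
    (hl : ∀ᵐ p ∂P, p.2 = 1 ∨ p.2 = -1) (φ : ℝ → ℝ) (hφc : Measurable φ)
    (hφ0 : ∀ α, 0 ≤ φ α) (hφ1 : ∀ α, φ α ≤ 1) (g : X → ℝ) (hg : Measurable g) (M : ℝ) :
    ∃ g' : X → ℝ, Measurable g' ∧ advRisk (margin φ) ε P g' ≤ advRisk l01 ε P g + φ M := by
  have hmm : Measurable (Function.uncurry (margin φ)) :=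
    hφc.comp (measurable_fst.mul measurable_snd)
  have hgm : Measurable (fun x => M * sgn (g x)) := (measurable_sgn.comp hg).const_mul M
  refine ⟨_, hgm, ?_⟩
  have h1 := advLoss_int measurable_l01 l01_nonneg l01_le_one ε hε P g hg
  have h2 := advLoss_int hmm (fun _ _ => hφ0 _) (fun _ _ => hφ1 _) ε hε P _ hgm
  unfold advRisk
  calc _ ≤ ∫ p, (advLoss l01 ε p.1 p.2 g + φ M) ∂P := by
        refine integral_mono_ae h2 (h1.add (integrable_const _)) ?_
        filter_upwards [hl] with p hp
        refine advLoss_le (add_nonneg (advLoss_nonneg l01_nonneg _ _ _ _) (hφ0 _)) fun x' hx' => ?_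
        refine le_trans ?_ (add_le_add_left (le_advLoss l01_le_one p.2 g hx') _)
        have e0 := hφ0 M
        have e1 := hφ1 (-M)
        have e2 := hφ1 M
        rcases hp with hp | hp
        · rw [hp, l01_one]
          by_cases h : g x' < 0
          · simp only [margin, sgn, h, not_le.2 h, if_true, if_false, one_mul, mul_neg, mul_one]
            linarith
          · simp [margin, sgn, h, not_lt.1 h]
        · rw [hp, l01_neg]
          by_cases h : 0 ≤ g x'
          · simp only [margin, sgn, h, if_true, mul_one, neg_mul, one_mul]
            linarith
          · simp [margin, sgn, h]
    _ = _ := by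
        rw [integral_add h1 (integrable_const _)]
        simp

end final

theorem stmt18 {X : Type*} [MetricSpace X] [ProperSpace X] [CompleteSpace X]
    [SecondCountableTopology X] [MeasurableSpace X] [BorelSpace X]
    (hmid : ∀ x₁ x₂ : X, ∃ x : X,
      dist x x₁ = dist x₁ x₂ / 2 ∧ dist x x₂ = dist x₁ x₂ / 2)
    (ε : ℝ) (hε : 0 ≤ ε)
    (P : Measure (X × ℝ)) [IsProbabilityMeasure P]
    (hlabels : P {p : X × ℝ | p.2 = 1 ∨ p.2 = -1} = 1)
    (lam τ : ℝ) (hlam : 0 ≤ lam) (hτ : 0 ≤ τ)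
    (ψ : ℝ → ℝ) (hcont : Continuous ψ) (hdec : Antitone ψ)
    (hodd : ∀ α, ψ (-α) = -ψ α)
    (hstrict : ∃ ρ > (0:ℝ), StrictAntiOn ψ (Icc (-ρ) ρ))
    (hlb : ∀ α, -lam ≤ ψ α)
    (φ : ℝ → ℝ) (hφ : ∀ α, φ α = lam + ψ (α - τ))
    (hlim1 : Tendsto φ atBot (nhds 1)) (hlim0 : Tendsto φ atTop (nhds 0))
    (Qs : Measure (X × ℝ)) (hQs : Qs ∈ advSet P ε)
    (hopt : ∀ Q ∈ advSet P ε,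
      (⨅ f : {f : X → ℝ // Measurable f}, stdRisk l01 Q f.1) ≤
        ⨅ f : {f : X → ℝ // Measurable f}, stdRisk l01 Qs f.1)
    (f : ℕ → X → ℝ) (hf : ∀ n, Measurable (f n))
    (hmin : Tendsto (fun n => advRisk (margin φ) ε P (f n)) atTop
      (nhds (⨅ g : {g : X → ℝ // Measurable g}, advRisk (margin φ) ε P g.1))) :
    Tendsto (fun n => stdRisk l01 Qs (f n)) atTop
      (nhds (⨅ g : {g : X → ℝ // Measurable g}, advRisk l01 ε P g.1)) := by
  have hφa : Antitone φ := fun a b hab => by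
    rw [hφ, hφ]; linarith [hdec (show a - τ ≤ b - τ by linarith)]
  have hφ0 : ∀ α, 0 ≤ φ α := fun α => hφa.le_of_tendsto hlim0 α
  have hφ1 : ∀ α, φ α ≤ 1 := fun α => hφa.ge_of_tendsto hlim1 α
  have hlam2 : lam = 1/2 := by
    have h1 : Tendsto (fun α => φ (τ + α) + φ (τ + -α)) atTop (nhds (0 + 1)) :=
      (hlim0.comp (tendsto_atTop_add_const_left _ τ tendsto_id)).add
        (hlim1.comp (tendsto_atBot_add_const_left _ τ tendsto_neg_atTop_atBot))
    have h2 : (fun α => φ (τ + α) + φ (τ + -α)) = fun _ => 2 * lam := by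
      ext α
      rw [hφ, hφ, show τ + α - τ = α by ring, show τ + -α - τ = -α by ring, hodd]; ring
    rw [h2] at h1
    have := tendsto_nhds_unique h1 tendsto_const_nhds
    linarith
  subst hlam2
  have hub : ∀ α, ψ α ≤ 1/2 := fun α => by
    have := hlb (-α); rw [hodd] at this; linarith
  have hφm : Measurable φ := by
    rw [show φ = fun α => 1/2 + ψ (α - τ) from funext hφ]
    exact (show Continuous fun α => 1/2 + ψ (α - τ) by fun_prop).measurable
  have hmm : Measurable (Function.uncurry (margin φ)) :=
    hφm.comp (measurable_fst.mul measurable_snd)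
  have hml : MeasurableSet {p : X × ℝ | p.2 = 1 ∨ p.2 = -1} :=
    (measurableSet_eq_fun measurable_snd measurable_const).union
      (measurableSet_eq_fun measurable_snd measurable_const)
  have hl : ∀ᵐ p ∂P, p.2 = 1 ∨ p.2 = -1 := (mem_ae_iff_prob_eq_one hml).2 hlabels
  have hlQ := advSet_labels hlabels hQs
  have hQp : IsProbabilityMeasure Qs := hQs.1
  have hne : Nonempty {g : X → ℝ // Measurable g} := ⟨⟨fun _ => 0, measurable_const⟩⟩
  set r := ⨅ g : {g : X → ℝ // Measurable g}, advRisk l01 ε P g.1 with hr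
  set q := ⨅ f : {f : X → ℝ // Measurable f}, stdRisk l01 Qs f.1 with hq
  set s := ⨅ g : {g : X → ℝ // Measurable g}, advRisk (margin φ) ε P g.1 with hs
  have hr' : ∀ g : X → ℝ, Measurable g → r ≤ advRisk l01 ε P g := fun g hg =>
    ciInf_le (f := fun g : {g : X → ℝ // Measurable g} => advRisk l01 ε P g.1)
      ⟨0, by rintro _ ⟨g, rfl⟩; exact integral_nonneg fun _ => advLoss_nonneg l01_nonneg _ _ _ _⟩
      ⟨g, hg⟩
  have hq' : ∀ g : X → ℝ, Measurable g → q ≤ stdRisk l01 Qs g := fun g hg =>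
    ciInf_le (f := fun g : {g : X → ℝ // Measurable g} => stdRisk l01 Qs g.1)
      ⟨0, by rintro _ ⟨g, rfl⟩; exact integral_nonneg fun _ => l01_nonneg _ _⟩
      ⟨g, hg⟩
  have hs' : ∀ g : X → ℝ, Measurable g → s ≤ advRisk (margin φ) ε P g := fun g hg =>
    ciInf_le (f := fun g : {g : X → ℝ // Measurable g} => advRisk (margin φ) ε P g.1)
      ⟨0, by
        rintro _ ⟨g, rfl⟩
        exact integral_nonneg fun _ => advLoss_nonneg (fun _ _ => hφ0 _) _ _ _ _⟩
      ⟨g, hg⟩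
  have hrq : r ≤ q := by
    obtain ⟨Q, hQ, hQr⟩ := duality ε hε P hl r hr'
    exact (le_ciInf fun g : {g : X → ℝ // Measurable g} => hQr g.1 g.2).trans (hopt Q hQ)
  have hsr : s ≤ r := by
    refine le_ciInf fun g => ?_
    have h1 : Tendsto (fun M => advRisk l01 ε P g.1 + φ M) atTop
        (nhds (advRisk l01 ε P g.1 + 0)) := hlim0.const_add _
    rw [add_zero] at h1
    refine ge_of_tendsto' h1 fun M => ?_
    obtain ⟨g', hg', h2⟩ := adv_surrogate_le ε hε P hl φ hφm hφ0 hφ1 g.1 g.2 M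
    exact (hs' g' hg').trans h2
  have hqr : q ≤ r := le_ciInf fun g => (hq' g.1 g.2).trans
    (stdRisk_le_advRisk measurable_l01 l01_nonneg l01_le_one ε hε P Qs hQs g.1 g.2)
  have hmain : ∀ g : X → ℝ, Measurable g →
      stdRisk l01 Qs g + q ≤ 2 * advRisk (margin φ) ε P g := fun g hg =>
    (surrogate Qs hlQ τ hτ ψ hcont hdec hodd hlb hub φ hφ q hq' g hg).trans
      (mul_le_mul_of_nonneg_left (stdRisk_le_advRisk hmm (fun _ _ => hφ0 _) (fun _ _ => hφ1 _)
        ε hε P Qs hQs g hg) (by norm_num))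
  have hqs : q ≤ s := le_ciInf fun g => by linarith [hmain g.1 g.2, hq' g.1 g.2]
  have hlim : Tendsto (fun n => 2 * advRisk (margin φ) ε P (f n) - q) atTop (nhds r) := by
    have := (hmin.const_mul 2).sub_const q
    rwa [show 2 * s - q = r by linarith] at this
  refine tendsto_of_tendsto_of_tendsto_of_le_of_le tendsto_const_nhds hlim (fun n => ?_)
    (fun n => ?_)
  · exact hrq.trans (hq' _ (hf n))
  · have := hmain (f n) (hf n)
    simp only
    linarith
end
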